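/- arXiv:1506.01242 — 11 statements merged into one kernel-verified Lean document; each statement's English description precedes it below -/
import Mathlib

section
/- Assume additionally that (iii) μ{x ∈ X : ψ_i(x) = r} = 0 for every i and every r ∈ ℝ. Define Σ_ψ(m) := inf_{p ∈ ℝ^N} ( Ξ⁰_ψ(p) + Σ_{i=1}^N p_i m_i ) for m in the simplex S_N := {m ∈ ℝ^N : m_i ≥ 0 for all i, Σ_i m_i ≤ 1}. Then Σ_ψ is strictly concave on S_N: for all m¹ ≠ m² in S_N and all t ∈ (0,1), Σ_ψ(t m¹ + (1−t) m²) > t Σ_ψ(m¹) + (1−t) Σ_ψ(m²). Consequently, for any capacity vector M with M_i > 0 and Σ_i M_i > 1 (over-saturation), there is a unique maximizer of Σ_ψ over the compact convex set {m ∈ S_N : m_i ≤ M_i for all i}. -/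
open MeasureTheory

/-- A feasible partition: measurable sets, capacity constraints, essentially disjoint. -/
def Feasible {X : Type*} [MeasurableSpace X] (μ : Measure X) {N : ℕ}
    (M : Fin N → ℝ) (A : Fin N → Set X) : Prop :=
  (∀ i, MeasurableSet (A i)) ∧ (∀ i, μ (A i) ≤ ENNReal.ofReal (M i)) ∧
  Pairwise fun i j => μ (A i ∩ A j) = 0

/-- Total profit of a partition. -/
noncomputable def totalProfit {X : Type*} [MeasurableSpace X] (μ : Measure X) {N : ℕ}
    (ψ : Fin N → X → ℝ) (A : Fin N → Set X) : ℝ :=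
  ∑ i, ∫ x in A i, ψ i x ∂μ

/-- The optimal total profit `Σ_ψ(M)`. -/
noncomputable def SigmaOpt {X : Type*} [MeasurableSpace X] (μ : Measure X) {N : ℕ}
    (ψ : Fin N → X → ℝ) (M : Fin N → ℝ) : ℝ :=
  sSup {s | ∃ A, Feasible μ M A ∧ s = totalProfit μ ψ A}

/-- The dual functional `Ξ⁰_ψ(p) = ∫ max_i (ψ_i - p_i)_+ dμ`. -/
noncomputable def Xi0 {X : Type*} [MeasurableSpace X] (μ : Measure X) {N : ℕ}
    (ψ : Fin N → X → ℝ) (p : Fin N → ℝ) : ℝ :=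
  ∫ x, (⨆ i, max (ψ i x - p i) 0) ∂μ

/-- Consumers giving up all agents at prices `p`. -/
def Aplus0 {X : Type*} {N : ℕ} (ψ : Fin N → X → ℝ) (p : Fin N → ℝ) : Set X :=
  {x | ∀ i, ψ i x ≤ p i}

/-- Consumers preferring agent `i` at prices `p`. -/
def Aplus {X : Type*} {N : ℕ} (ψ : Fin N → X → ℝ) (p : Fin N → ℝ) (i : Fin N) : Set X :=
  {x | ∀ j, ψ j x - p j ≤ ψ i x - p i} \ Aplus0 ψ p

/-- The optimal-profit function `m ↦ Σ_ψ(m)` given by the dual formula. -/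
noncomputable def SigmaInf {X : Type*} [MeasurableSpace X] (μ : Measure X) {N : ℕ}
    (ψ : Fin N → X → ℝ) (m : Fin N → ℝ) : ℝ :=
  sInf {y | ∃ p : Fin N → ℝ, y = Xi0 μ ψ p + ∑ i, p i * m i}

open Set Filter Topology

section UniformAtomlessness

variable {X : Type*} [TopologicalSpace X] [CompactSpace X] [MeasurableSpace X] [BorelSpace X]
  {μ : Measure X} [IsFiniteMeasure μ]

/-- A continuous function with null level sets on a compact space has a uniformly
nonconcentrated law. -/
theorem exists_pos_forall_measureReal_abs_sub_lt_le {f : X → ℝ} (hf : Continuous f)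
    (h0 : ∀ r : ℝ, μ {x | f x = r} = 0) {η : ℝ} (hη : 0 < η) :
    ∃ δ > 0, ∀ r : ℝ, μ.real {x | |f x - r| < δ} ≤ η := by
  have hloc : ∀ r : ℝ, ∃ δ > 0, μ.real {x | |f x - r| < δ} ≤ η := by
    intro r
    have hlim : Tendsto (fun n : ℕ => μ {x | |f x - r| < 1 / ((n : ℝ) + 1)}) atTop
        (𝓝 (μ (⋂ n : ℕ, {x | |f x - r| < 1 / ((n : ℝ) + 1)}))) := by
      refine tendsto_measure_iInter_atTop
        (fun n => (isOpen_lt (by fun_prop) continuous_const).measurableSet.nullMeasurableSet)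
        (fun m n hmn x (hx : |f x - r| < _) => hx.trans_le (Nat.one_div_le_one_div hmn))
        ⟨0, measure_ne_top _ _⟩
    have hnull : μ (⋂ n : ℕ, {x | |f x - r| < 1 / ((n : ℝ) + 1)}) = 0 := by
      refine measure_mono_null (fun x hx => ?_) (h0 r)
      by_contra hne
      obtain ⟨n, hn⟩ := exists_nat_one_div_lt (abs_pos.2 (sub_ne_zero.2 hne))
      exact absurd (mem_iInter.1 hx n) (not_lt.2 hn.le)
    rw [hnull] at hlim
    obtain ⟨n, hn⟩ := (hlim.eventually_lt_const (ENNReal.ofReal_pos.2 hη)).exists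
    exact ⟨1 / ((n : ℝ) + 1), by positivity,
      ENNReal.toReal_le_of_le_ofReal hη.le hn.le⟩
  choose d hd hdη using hloc
  obtain ⟨δ, hδ, hleb⟩ := lebesgue_number_lemma_of_metric (isCompact_range hf)
    (fun r => Metric.isOpen_ball (x := r) (ε := d r))
    (fun r _ => mem_iUnion.2 ⟨r, Metric.mem_ball_self (hd r)⟩)
  refine ⟨δ / 2, by positivity, fun r => ?_⟩
  rcases eq_empty_or_nonempty {x | |f x - r| < δ / 2} with he | ⟨y, hy⟩
  · rw [he]; simpa using hη.le
  · obtain ⟨s, hs⟩ := hleb (f y) (mem_range_self y)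
    refine le_trans (measureReal_mono (fun x hx => ?_)) (hdη s)
    have hx' : dist (f x) r < δ / 2 := hx
    have hy' : dist (f y) r < δ / 2 := hy
    exact hs (Metric.mem_ball.2 (by linarith [dist_triangle_right (f x) (f y) r]))

/-- Uniform nonconcentration for a finite family of functions. -/
theorem exists_pos_forall_measureReal_iUnion_abs_sub_lt_le {ι : Type*} [Fintype ι]
    {f : ι → X → ℝ} (hf : ∀ i, Continuous (f i))
    (h0 : ∀ i (r : ℝ), μ {x | f i x = r} = 0) {η : ℝ} (hη : 0 < η) :
    ∃ δ > 0, ∀ r : ι → ℝ, μ.real (⋃ i, {x | |f i x - r i| < δ}) ≤ η := by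
  have hc : 0 < η / (Fintype.card ι + 1) := by positivity
  choose d hd hdη using fun i => exists_pos_forall_measureReal_abs_sub_lt_le (hf i) (h0 i) hc
  obtain ⟨δ, hδ, hle⟩ : ∃ δ > 0, ∀ i, δ ≤ d i := by
    have hev : ∀ᶠ δ in 𝓝[>] (0 : ℝ), ∀ i, δ ≤ d i := eventually_all.2 fun i =>
      nhdsWithin_le_nhds (eventually_le_nhds (hd i))
    obtain ⟨δ, hδ, hpos⟩ := (hev.and self_mem_nhdsWithin).exists
    exact ⟨δ, hpos, hδ⟩
  refine ⟨δ, hδ, fun r => ?_⟩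
  calc μ.real (⋃ i, {x | |f i x - r i| < δ})
      ≤ ∑ i, μ.real {x | |f i x - r i| < δ} := measureReal_iUnion_fintype_le _
    _ ≤ ∑ _i : ι, η / (Fintype.card ι + 1) := Finset.sum_le_sum fun i _ =>
        (measureReal_mono fun x hx => lt_of_lt_of_le hx (hle i)).trans (hdη i (r i))
    _ ≤ η := by
        rw [Finset.sum_const, Finset.card_univ, nsmul_eq_mul, mul_div_assoc',
          div_le_iff₀ (by positivity)]
        nlinarith

end UniformAtomlessness

section PositiveMax

variable {ι : Type*} [Finite ι]

theorem le_iSup_max_zero (v : ι → ℝ) (i : ι) : v i ≤ ⨆ j, max (v j) 0 :=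
  (le_max_left _ _).trans (le_ciSup (f := fun j => max (v j) 0) (finite_range _).bddAbove i)

theorem iSup_max_zero_nonneg {ι : Type*} (v : ι → ℝ) : 0 ≤ ⨆ j, max (v j) 0 :=
  Real.iSup_nonneg fun _ => le_max_right _ _

theorem iSup_max_zero_le {ι : Type*} {v : ι → ℝ} {b : ℝ} (hb : 0 ≤ b) (h : ∀ i, v i ≤ b) :
    ⨆ j, max (v j) 0 ≤ b :=
  Real.iSup_le (fun i => max_le (h i) hb) hb

/-- Second differences of the positive maximum are controlled by the size of the step. -/
theorem iSup_max_zero_add_sub_le {v u : ι → ℝ} {d : ℝ} (hd : 0 ≤ d) (hu : ∀ i, |u i| ≤ d) :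
    (⨆ j, max (v j + u j) 0) + (⨆ j, max (v j - u j) 0) ≤ 2 * (⨆ j, max (v j) 0) + 2 * d := by
  have h0 := iSup_max_zero_nonneg v
  have h1 : ⨆ j, max (v j + u j) 0 ≤ (⨆ j, max (v j) 0) + d :=
    iSup_max_zero_le (by linarith) fun i => by
      linarith [le_iSup_max_zero v i, (abs_le.1 (hu i)).2]
  have h2 : ⨆ j, max (v j - u j) 0 ≤ (⨆ j, max (v j) 0) + d :=
    iSup_max_zero_le (by linarith) fun i => by
      linarith [le_iSup_max_zero v i, (abs_le.1 (hu i)).1]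
  linarith

/-- Second differences of the positive maximum vanish for steps that cannot change its selector. -/
theorem iSup_max_zero_add_sub_le_of_separated {v u : ι → ℝ} {d : ℝ}
    (hu : ∀ i, |u i| ≤ d) (h0 : ∀ i, 2 * d ≤ |v i|)
    (h : ∀ i j, i ≠ j → 2 * d ≤ |v i - v j|) :
    (⨆ j, max (v j + u j) 0) + (⨆ j, max (v j - u j) 0) ≤ 2 * (⨆ j, max (v j) 0) := by
  have hu' := fun i => abs_le.1 (hu i)
  by_cases hneg : ∀ i, v i ≤ 0
  · have hv : ∀ i, v i ≤ -(2 * d) := fun i => by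
      have := h0 i
      rw [abs_of_nonpos (hneg i)] at this
      linarith
    have h1 : ⨆ j, max (v j + u j) 0 ≤ 0 := iSup_max_zero_le le_rfl fun i => by
      linarith [hv i, hu' i |>.1, hu' i |>.2]
    have h2 : ⨆ j, max (v j - u j) 0 ≤ 0 := iSup_max_zero_le le_rfl fun i => by
      linarith [hv i, hu' i |>.1, hu' i |>.2]
    linarith [iSup_max_zero_nonneg v]
  · push Not at hneg
    obtain ⟨k, hk⟩ := hneg
    have : Nonempty ι := ⟨k⟩
    obtain ⟨i, hi⟩ := Finite.exists_max v
    have hi0 : 2 * d ≤ v i := by simpa [abs_of_pos (hk.trans_le (hi k))] using h0 i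
    have hgap : ∀ j, j = i ∨ 2 * d ≤ v i - v j := fun j => by
      rcases eq_or_ne j i with hj | hj
      · exact Or.inl hj
      · right
        simpa [abs_of_nonneg (sub_nonneg.2 (hi j))] using h i j hj.symm
    have h1 : ⨆ j, max (v j + u j) 0 ≤ v i + u i :=
      iSup_max_zero_le (by linarith [hu' i |>.1, hu' i |>.2]) fun j => by
        rcases hgap j with rfl | hj
        · rfl
        · linarith [hu' i |>.1, hu' i |>.2, hu' j |>.1, hu' j |>.2]
    have h2 : ⨆ j, max (v j - u j) 0 ≤ v i - u i :=
      iSup_max_zero_le (by linarith [hu' i |>.1, hu' i |>.2]) fun j => by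
        rcases hgap j with rfl | hj
        · rfl
        · linarith [hu' i |>.1, hu' i |>.2, hu' j |>.1, hu' j |>.2]
    linarith [le_iSup_max_zero v i]

end PositiveMax

section DualFunctional

theorem exists_dual_value_lt {X : Type*} [MeasurableSpace X] {μ : Measure X} {N : ℕ}
    {ψ : Fin N → X → ℝ} {m : Fin N → ℝ} {b : ℝ} (h : SigmaInf μ ψ m < b) :
    ∃ p : Fin N → ℝ, Xi0 μ ψ p + ∑ i, p i * m i < b := by
  have hne : {y | ∃ p : Fin N → ℝ, y = Xi0 μ ψ p + ∑ i, p i * m i}.Nonempty := ⟨_, 0, rfl⟩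
  obtain ⟨_, ⟨p, rfl⟩, hp⟩ := exists_lt_of_csInf_lt hne h
  exact ⟨p, hp⟩

variable {X : Type*} [TopologicalSpace X] [CompactSpace X] [MeasurableSpace X] [BorelSpace X]
  {μ : Measure X} {N : ℕ} {ψ : Fin N → X → ℝ}

theorem integrable_of_continuous_of_compactSpace [IsFiniteMeasure μ] {f : X → ℝ}
    (hf : Continuous f) : Integrable f μ :=
  hf.integrable_of_hasCompactSupport (HasCompactSupport.of_compactSpace f)

theorem integrable_iSup_max_zero [IsFiniteMeasure μ] (hψ : ∀ i, Continuous (ψ i))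
    (p : Fin N → ℝ) : Integrable (fun x => ⨆ i, max (ψ i x - p i) 0) μ := by
  refine Integrable.mono' (g := fun x => ∑ i, |ψ i x - p i|)
    (integrable_of_continuous_of_compactSpace (by fun_prop))
    (Measurable.iSup fun i => ((hψ i).measurable.sub_const _).max
      measurable_const).aestronglyMeasurable (.of_forall fun x => ?_)
  rw [Real.norm_of_nonneg (iSup_max_zero_nonneg _)]
  exact iSup_max_zero_le (Finset.sum_nonneg fun i _ => abs_nonneg _) fun i =>
    (le_abs_self _).trans
      (Finset.single_le_sum (f := fun i => |ψ i x - p i|) (fun i _ => abs_nonneg _)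
        (Finset.mem_univ i))

/-- Weak duality. -/
theorem sum_mul_integral_le_Xi0_add [IsProbabilityMeasure μ] (hψ : ∀ i, Continuous (ψ i))
    {m : Fin N → ℝ} (hm : ∀ i, 0 ≤ m i) (hm1 : ∑ i, m i ≤ 1) (p : Fin N → ℝ) :
    ∑ i, m i * ∫ x, ψ i x ∂μ ≤ Xi0 μ ψ p + ∑ i, p i * m i := by
  have hint : ∀ i, Integrable (fun x => m i * (ψ i x - p i)) μ := fun i =>
    integrable_of_continuous_of_compactSpace (by fun_prop)
  have hle : ∫ x, ∑ i, m i * (ψ i x - p i) ∂μ ≤ Xi0 μ ψ p := by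
    refine integral_mono (integrable_finsetSum _ fun i _ => hint i)
      (integrable_iSup_max_zero hψ p) fun x => ?_
    calc ∑ i, m i * (ψ i x - p i) ≤ ∑ i, m i * ⨆ j, max (ψ j x - p j) 0 :=
          Finset.sum_le_sum fun i _ => mul_le_mul_of_nonneg_left
            (le_iSup_max_zero (fun j => ψ j x - p j) i) (hm i)
      _ = (∑ i, m i) * ⨆ j, max (ψ j x - p j) 0 := (Finset.sum_mul ..).symm
      _ ≤ ⨆ j, max (ψ j x - p j) 0 := mul_le_of_le_one_left (iSup_max_zero_nonneg _) hm1
  have heq : ∫ x, ∑ i, m i * (ψ i x - p i) ∂μ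
      = ∑ i, m i * ∫ x, ψ i x ∂μ - ∑ i, p i * m i := by
    rw [integral_finsetSum _ fun i _ => hint i, ← Finset.sum_sub_distrib]
    refine Finset.sum_congr rfl fun i _ => ?_
    rw [integral_const_mul, integral_sub (integrable_of_continuous_of_compactSpace (hψ i))
      (integrable_const _), integral_const]
    simp only [probReal_univ, one_smul]
    ring
  linarith

theorem bddBelow_dual_values [IsProbabilityMeasure μ] (hψ : ∀ i, Continuous (ψ i))
    {m : Fin N → ℝ} (hm : ∀ i, 0 ≤ m i) (hm1 : ∑ i, m i ≤ 1) :
    BddBelow {y | ∃ p : Fin N → ℝ, y = Xi0 μ ψ p + ∑ i, p i * m i} :=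
  ⟨_, by rintro _ ⟨p, rfl⟩; exact sum_mul_integral_le_Xi0_add hψ hm hm1 p⟩

theorem SigmaInf_le [IsProbabilityMeasure μ] (hψ : ∀ i, Continuous (ψ i))
    {m : Fin N → ℝ} (hm : ∀ i, 0 ≤ m i) (hm1 : ∑ i, m i ≤ 1) (p : Fin N → ℝ) :
    SigmaInf μ ψ m ≤ Xi0 μ ψ p + ∑ i, p i * m i :=
  csInf_le (bddBelow_dual_values hψ hm hm1) ⟨p, rfl⟩

theorem upperSemicontinuousOn_SigmaInf [IsProbabilityMeasure μ] (hψ : ∀ i, Continuous (ψ i)) :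
    UpperSemicontinuousOn (SigmaInf μ ψ) {m | (∀ i, 0 ≤ m i) ∧ ∑ i, m i ≤ 1} := by
  intro m hm b hb
  obtain ⟨p, hp⟩ := exists_dual_value_lt hb
  have hc : Continuous fun m' : Fin N → ℝ => Xi0 μ ψ p + ∑ i, p i * m' i := by fun_prop
  filter_upwards [self_mem_nhdsWithin,
    nhdsWithin_le_nhds (hc.continuousAt.eventually_lt_const hp)] with m' hm' hlt
  exact (SigmaInf_le hψ hm'.1 hm'.2 p).trans_lt hlt

/-- The dual functional is uniformly smooth: its second differences are uniformly `o(h)`. -/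
theorem exists_pos_forall_Xi0_add_sub_le [IsFiniteMeasure μ] (hψ : ∀ i, Continuous (ψ i))
    (htwist : ∀ i j, i ≠ j → ∀ r : ℝ, μ {x | ψ i x - ψ j x = r} = 0)
    (hlevel : ∀ i (r : ℝ), μ {x | ψ i x = r} = 0) {η : ℝ} (hη : 0 < η) :
    ∃ h > 0, ∀ p e : Fin N → ℝ, (∀ i, |e i| ≤ 1) →
      Xi0 μ ψ (fun i => p i - h * e i) + Xi0 μ ψ (fun i => p i + h * e i)
        ≤ 2 * Xi0 μ ψ p + 2 * h * η := by
  let f : Fin N ⊕ {q : Fin N × Fin N // q.1 ≠ q.2} → X → ℝ :=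
    Sum.elim ψ fun q x => ψ q.1.1 x - ψ q.1.2 x
  have hf : ∀ k, Continuous (f k) := by
    rintro (i | q)
    · exact hψ i
    · exact (hψ _).sub (hψ _)
  have hf0 : ∀ k (r : ℝ), μ {x | f k x = r} = 0 := by
    rintro (i | q) r
    · exact hlevel i r
    · exact htwist _ _ q.2 r
  obtain ⟨δ, hδ, hsmall⟩ := exists_pos_forall_measureReal_iUnion_abs_sub_lt_le hf hf0 hη
  refine ⟨δ / 2, by positivity, fun p e he => ?_⟩
  set h := δ / 2 with hh
  have hpos : 0 < h := by positivity
  let B : Set X := ⋃ k, {x | |f k x - Sum.elim p (fun q => p q.1.1 - p q.1.2) k| < δ}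
  have hB : MeasurableSet B := MeasurableSet.iUnion fun k =>
    (isOpen_lt ((hf k).sub continuous_const).abs continuous_const).measurableSet
  have hstep : ∀ i, |h * e i| ≤ h := fun i => by
    rw [abs_mul, abs_of_pos hpos]
    exact mul_le_of_le_one_right hpos.le (he i)
  have hpt : ∀ x, (⨆ i, max (ψ i x - (p i - h * e i)) 0) + (⨆ i, max (ψ i x - (p i + h * e i)) 0)
      ≤ 2 * (⨆ i, max (ψ i x - p i) 0) + B.indicator (fun _ => 2 * h) x := by
    intro x
    simp only [sub_sub_eq_add_sub, ← sub_sub, add_sub_right_comm]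
    by_cases hx : x ∈ B
    · rw [indicator_of_mem hx]
      exact iSup_max_zero_add_sub_le (v := fun i => ψ i x - p i) hpos.le hstep
    · rw [indicator_of_notMem hx, add_zero]
      have hx' : ∀ k, δ ≤ |f k x - Sum.elim p (fun q => p q.1.1 - p q.1.2) k| := fun k =>
        not_lt.1 fun hk => hx (mem_iUnion.2 ⟨k, hk⟩)
      refine iSup_max_zero_add_sub_le_of_separated (v := fun i => ψ i x - p i) hstep
        (fun i => ?_) (fun i j hij => ?_)
      · rw [hh, mul_div_cancel₀ _ two_ne_zero]
        exact hx' (.inl i)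
      · rw [hh, mul_div_cancel₀ _ two_ne_zero, sub_sub_sub_comm]
        exact hx' (.inr ⟨(i, j), hij⟩)
  have hI := fun q => integrable_iSup_max_zero (μ := μ) hψ q
  have hIB : Integrable (B.indicator fun _ => 2 * h) μ := (integrable_const _).indicator hB
  calc Xi0 μ ψ (fun i => p i - h * e i) + Xi0 μ ψ (fun i => p i + h * e i)
      = ∫ x, ((⨆ i, max (ψ i x - (p i - h * e i)) 0)
          + ⨆ i, max (ψ i x - (p i + h * e i)) 0) ∂μ :=
        (integral_add (hI _) (hI _)).symm
    _ ≤ ∫ x, (2 * (⨆ i, max (ψ i x - p i) 0) + B.indicator (fun _ => 2 * h) x) ∂μ :=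
        integral_mono ((hI _).add (hI _)) (((hI p).const_mul 2).add hIB) hpt
    _ = 2 * Xi0 μ ψ p + μ.real B * (2 * h) := by
        rw [integral_add ((hI p).const_mul 2) hIB, integral_const_mul,
          integral_indicator_const _ hB, smul_eq_mul, Xi0]
    _ ≤ 2 * Xi0 μ ψ p + 2 * h * η := by
        have := mul_le_mul_of_nonneg_right (hsmall (Sum.elim p fun q => p q.1.1 - p q.1.2))
          (by positivity : 0 ≤ 2 * h)
        linarith

/-- Strict concavity of the dual formula on the simplex. -/
theorem SigmaInf_strictConcave [IsProbabilityMeasure μ] (hψ : ∀ i, Continuous (ψ i))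
    (htwist : ∀ i j, i ≠ j → ∀ r : ℝ, μ {x | ψ i x - ψ j x = r} = 0)
    (hlevel : ∀ i (r : ℝ), μ {x | ψ i x = r} = 0) {m₁ m₂ : Fin N → ℝ}
    (hm₁ : (∀ i, 0 ≤ m₁ i) ∧ ∑ i, m₁ i ≤ 1) (hm₂ : (∀ i, 0 ≤ m₂ i) ∧ ∑ i, m₂ i ≤ 1)
    (hne : m₁ ≠ m₂) {t : ℝ} (ht : 0 < t) (ht1 : t < 1) :
    t * SigmaInf μ ψ m₁ + (1 - t) * SigmaInf μ ψ m₂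
      < SigmaInf μ ψ (fun i => t * m₁ i + (1 - t) * m₂ i) := by
  by_contra! hcon
  have hs : 0 < 1 - t := by linarith
  have hle_one : ∀ {m : Fin N → ℝ}, ((∀ i, 0 ≤ m i) ∧ ∑ i, m i ≤ 1) → ∀ i, m i ≤ 1 :=
    fun hm i => (Finset.single_le_sum (fun i _ => hm.1 i) (Finset.mem_univ i)).trans hm.2
  let e : Fin N → ℝ := fun i => m₁ i - m₂ i
  have he : ∀ i, |e i| ≤ 1 := fun i => abs_le.2
    ⟨by linarith [hm₁.1 i, hle_one hm₂ i], by linarith [hm₂.1 i, hle_one hm₁ i]⟩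
  obtain ⟨k, hk⟩ := Function.ne_iff.1 hne
  have hE : 0 < ∑ i, e i * e i := Finset.sum_pos' (fun i _ => mul_self_nonneg _)
    ⟨k, Finset.mem_univ k, mul_self_pos.2 (sub_ne_zero.2 hk)⟩
  set E := ∑ i, e i * e i
  obtain ⟨h, hpos, hsmooth⟩ := exists_pos_forall_Xi0_add_sub_le hψ htwist hlevel
    (by positivity : 0 < E / 4)
  obtain ⟨p, hp⟩ := exists_dual_value_lt (hcon.trans_lt
    (lt_add_of_pos_right _ (by positivity : 0 < t * (1 - t) * (h * E / 8))))
  have hsplit : Xi0 μ ψ p + ∑ i, p i * (t * m₁ i + (1 - t) * m₂ i)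
      = t * (Xi0 μ ψ p + ∑ i, p i * m₁ i) + (1 - t) * (Xi0 μ ψ p + ∑ i, p i * m₂ i) := by
    have : ∑ i, p i * (t * m₁ i + (1 - t) * m₂ i)
        = t * ∑ i, p i * m₁ i + (1 - t) * ∑ i, p i * m₂ i := by
      rw [Finset.mul_sum, Finset.mul_sum, ← Finset.sum_add_distrib]
      exact Finset.sum_congr rfl fun i _ => by ring
    rw [this]; ring
  rw [hsplit] at hp
  have hp₁ := SigmaInf_le (μ := μ) hψ hm₁.1 hm₁.2 p
  have hp₂ := SigmaInf_le (μ := μ) hψ hm₂.1 hm₂.2 p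
  have hnear₁ : Xi0 μ ψ p + ∑ i, p i * m₁ i < SigmaInf μ ψ m₁ + h * E / 8 := by
    have : 0 < h * E / 8 := by positivity
    by_contra! hc
    nlinarith [mul_nonneg hs.le (sub_nonneg.2 hp₂), mul_le_mul_of_nonneg_left hc ht.le,
      mul_pos (mul_pos ht ht) this]
  have hnear₂ : Xi0 μ ψ p + ∑ i, p i * m₂ i < SigmaInf μ ψ m₂ + h * E / 8 := by
    have : 0 < h * E / 8 := by positivity
    by_contra! hc
    nlinarith [mul_nonneg ht.le (sub_nonneg.2 hp₁), mul_le_mul_of_nonneg_left hc hs.le,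
      mul_pos (mul_pos hs hs) this]
  have hq₁ := SigmaInf_le (μ := μ) hψ hm₁.1 hm₁.2 (fun i => p i - h * e i)
  have hq₂ := SigmaInf_le (μ := μ) hψ hm₂.1 hm₂.2 (fun i => p i + h * e i)
  have hsum : ∑ i, (p i - h * e i) * m₁ i + ∑ i, (p i + h * e i) * m₂ i
      = ∑ i, p i * m₁ i + ∑ i, p i * m₂ i - h * E := by
    rw [Finset.mul_sum, ← Finset.sum_add_distrib, ← Finset.sum_add_distrib,
      ← Finset.sum_sub_distrib]
    exact Finset.sum_congr rfl fun i _ => by simp only [e]; ring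
  have := hsmooth p e he
  have : 0 < h * E := by positivity
  linarith

end DualFunctional

/-- strict concavity of `Σ_ψ` on the simplex and uniqueness of the
maximizer in the over-saturated case. -/
theorem sigma_strictConcave_and_unique_maximizer
    {X : Type*} [TopologicalSpace X] [CompactSpace X] [T2Space X]
    [MeasurableSpace X] [BorelSpace X]
    (μ : Measure X) [IsProbabilityMeasure μ]
    {N : ℕ} (hN : 1 ≤ N)
    (ψ : Fin N → X → ℝ) (hψc : ∀ i, Continuous (ψ i))
    (hpos : ∀ i, μ {x | ψ i x ≤ 0} = 0)
    (htwist : ∀ i j, i ≠ j → ∀ r : ℝ, μ {x | ψ i x - ψ j x = r} = 0)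
    (hiii : ∀ i (r : ℝ), μ {x | ψ i x = r} = 0) :
    (∀ m₁ m₂ : Fin N → ℝ,
      ((∀ i, 0 ≤ m₁ i) ∧ ∑ i, m₁ i ≤ 1) → ((∀ i, 0 ≤ m₂ i) ∧ ∑ i, m₂ i ≤ 1) →
      m₁ ≠ m₂ → ∀ t : ℝ, 0 < t → t < 1 →
        t * SigmaInf μ ψ m₁ + (1 - t) * SigmaInf μ ψ m₂ <
          SigmaInf μ ψ (fun i => t * m₁ i + (1 - t) * m₂ i)) ∧
    (∀ M : Fin N → ℝ, (∀ i, 0 < M i) → 1 < ∑ i, M i →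
      ∃! m : Fin N → ℝ,
        ((∀ i, 0 ≤ m i) ∧ ∑ i, m i ≤ 1 ∧ ∀ i, m i ≤ M i) ∧
        ∀ m' : Fin N → ℝ, ((∀ i, 0 ≤ m' i) ∧ ∑ i, m' i ≤ 1 ∧ ∀ i, m' i ≤ M i) →
          SigmaInf μ ψ m' ≤ SigmaInf μ ψ m) := by
  have hconc {m₁ m₂ : Fin N → ℝ} (hm₁ : (∀ i, 0 ≤ m₁ i) ∧ ∑ i, m₁ i ≤ 1)
      (hm₂ : (∀ i, 0 ≤ m₂ i) ∧ ∑ i, m₂ i ≤ 1) (hne : m₁ ≠ m₂) {t : ℝ} (ht : 0 < t)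
      (ht1 : t < 1) := SigmaInf_strictConcave hψc htwist hiii hm₁ hm₂ hne ht ht1
  refine ⟨fun m₁ m₂ hm₁ hm₂ hne t ht ht1 => hconc hm₁ hm₂ hne ht ht1, fun M hM _ => ?_⟩
  let K : Set (Fin N → ℝ) := {m | (∀ i, 0 ≤ m i) ∧ ∑ i, m i ≤ 1 ∧ ∀ i, m i ≤ M i}
  have hK : IsCompact K := by
    have hK' : K = Icc 0 M ∩ {m | ∑ i, m i ≤ 1} := by
      ext m
      simp only [K, mem_ofPred_eq, mem_inter_iff, mem_Icc, Pi.le_def, Pi.zero_apply]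
      tauto
    rw [hK']
    exact isCompact_Icc.inter_right (isClosed_le (by fun_prop) continuous_const)
  obtain ⟨m, hm, hmax⟩ := UpperSemicontinuousOn.exists_isMaxOn
    (⟨0, by simp [K, fun i => (hM i).le]⟩ : K.Nonempty) hK
    ((upperSemicontinuousOn_SigmaInf (μ := μ) hψc).mono fun m hm => ⟨hm.1, hm.2.1⟩)
  refine ⟨m, ⟨hm, fun m' hm' => hmax hm'⟩, fun m' ⟨hm', hmax'⟩ => ?_⟩
  by_contra hne
  have hlt := hconc ⟨hm'.1, hm'.2.1⟩ ⟨hm.1, hm.2.1⟩ hne one_half_pos one_half_lt_one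
  have hmid : (fun i => 1 / 2 * m' i + (1 - 1 / 2) * m i) ∈ K := by
    refine ⟨fun i => by linarith [hm.1 i, hm'.1 i], ?_,
      fun i => by linarith [hm.2.2 i, hm'.2.2 i]⟩
    rw [Finset.sum_add_distrib, ← Finset.mul_sum, ← Finset.mul_sum]
    linarith [hm.2.1, hm'.2.1]
  linarith [hmax' _ hmid, hmax' m hm, show SigmaInf μ ψ m' ≤ SigmaInf μ ψ m from hmax hm']
end

section
/- Let β > 0 be a constant and set ψ̃_1 := β ψ_1 (keeping ψ_2, …, ψ_N and M unchanged), and assume the system (ψ̃_1, ψ_2, …, ψ_N) also satisfies assumptions (i) and (ii). If β > 1 then P̃_1 ≥ β P̄_1, and if β < 1 then P̃_1 ≤ β P̄_1. -/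
open MeasureTheory

/-- A feasible partition earns at most the optimal total profit when the wisdoms are integrable. -/
theorem Feasible.totalProfit_le_sigmaOpt {X : Type*} [MeasurableSpace X] {μ : Measure X} {N : ℕ}
    {ψ : Fin N → X → ℝ} {M : Fin N → ℝ} {A : Fin N → Set X}
    (hψ : ∀ i, Integrable (ψ i) μ) (hA : Feasible μ M A) :
    totalProfit μ ψ A ≤ SigmaOpt μ ψ M := by
  refine le_csSup ⟨∑ i, ∫ x, |ψ i x| ∂μ, ?_⟩ ⟨A, hA, rfl⟩
  rintro _ ⟨B, -, rfl⟩
  refine Finset.sum_le_sum fun i _ => ?_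
  calc ∫ x in B i, ψ i x ∂μ ≤ ∫ x in B i, |ψ i x| ∂μ :=
        integral_mono (hψ i).integrableOn (hψ i).abs.integrableOn fun x => le_abs_self _
    _ ≤ ∫ x, |ψ i x| ∂μ :=
        setIntegral_le_integral (hψ i).abs (Filter.Eventually.of_forall fun x => abs_nonneg _)

/-- Scaling the wisdom of agent `0` only affects her own contribution to the total profit. -/
theorem totalProfit_update_zero_mul {X : Type*} [MeasurableSpace X] (μ : Measure X) {N : ℕ}
    (ψ : Fin (N + 1) → X → ℝ) (β : ℝ) (A : Fin (N + 1) → Set X) :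
    totalProfit μ (Function.update ψ 0 fun x => β * ψ 0 x) A =
      totalProfit μ ψ A + (β - 1) * ∫ x in A 0, ψ 0 x ∂μ := by
  simp only [totalProfit, Fin.sum_univ_succ, Function.update_self, ne_eq, Fin.succ_ne_zero,
    not_false_eq_true, Function.update_of_ne, integral_const_mul]
  ring

/-- Theorem `new0` (i): multiplying the wisdom of agent 1 by a
constant `β` multiplies her individual value at least (resp. at most) by `β`. -/
theorem individual_value_scaling
    {X : Type*} [TopologicalSpace X] [CompactSpace X] [T2Space X]
    [MeasurableSpace X] [BorelSpace X]
    (μ : Measure X) [IsProbabilityMeasure μ]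
    {N : ℕ}
    (ψ : Fin (N + 1) → X → ℝ) (hψc : ∀ i, Continuous (ψ i))
    (hpos : ∀ i, μ {x | ψ i x ≤ 0} = 0)
    (htwist : ∀ i j, i ≠ j → ∀ r : ℝ, μ {x | ψ i x - ψ j x = r} = 0)
    (M : Fin (N + 1) → ℝ) (hM : ∀ i, 0 < M i)
    (β : ℝ) (hβ : 0 < β)
    (ψt : Fin (N + 1) → X → ℝ)
    (hψt : ψt = Function.update ψ 0 (fun x => β * ψ 0 x))
    (hpos' : ∀ i, μ {x | ψt i x ≤ 0} = 0)
    (htwist' : ∀ i j, i ≠ j → ∀ r : ℝ, μ {x | ψt i x - ψt j x = r} = 0)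
    (Abar Atil : Fin (N + 1) → Set X)
    (hAbarF : Feasible μ M Abar) (hAbarOpt : totalProfit μ ψ Abar = SigmaOpt μ ψ M)
    (hAtilF : Feasible μ M Atil) (hAtilOpt : totalProfit μ ψt Atil = SigmaOpt μ ψt M) :
    (1 < β → β * ∫ x in Abar 0, ψ 0 x ∂μ ≤ ∫ x in Atil 0, ψt 0 x ∂μ) ∧
    (β < 1 → ∫ x in Atil 0, ψt 0 x ∂μ ≤ β * ∫ x in Abar 0, ψ 0 x ∂μ) := by
  have hint : ∀ i, Integrable (ψ i) μ := fun i =>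
    (hψc i).integrable_of_hasCompactSupport (.of_compactSpace _)
  have hint' : ∀ i, Integrable (ψt i) μ := by
    intro i
    rw [hψt]
    refine Fin.cases ?_ (fun j => ?_) i
    · simpa using (hint 0).const_mul β
    · simpa [Fin.succ_ne_zero] using hint j.succ
  have hle := hAbarOpt ▸ hAtilF.totalProfit_le_sigmaOpt hint
  have hle' := hAtilOpt ▸ hAbarF.totalProfit_le_sigmaOpt hint'
  rw [hψt, totalProfit_update_zero_mul, totalProfit_update_zero_mul] at hle'
  have hval : ∫ x in Atil 0, ψt 0 x ∂μ = β * ∫ x in Atil 0, ψ 0 x ∂μ := by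
    rw [hψt, Function.update_self, integral_const_mul]
  rw [hval]
  constructor <;> intro h <;> refine mul_le_mul_of_nonneg_left ?_ hβ.le <;> nlinarith
end

section
/- Let β > 1 be a constant and suppose ψ̃_1(x) ≥ β ψ_1(x) for every x ∈ X (keeping ψ_2, …, ψ_N and M unchanged), and assume the system (ψ̃_1, ψ_2, …, ψ_N) also satisfies assumptions (i) and (ii). Then P̃_1 ≥ (β − 1) P̄_1. -/
open MeasureTheory

theorem le_SigmaOpt {X : Type*} [MeasurableSpace X] {μ : Measure X} {N : ℕ}
    {ψ : Fin N → X → ℝ} (hψ : ∀ i, Integrable (ψ i) μ) {M : Fin N → ℝ}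
    {A : Fin N → Set X} (hA : Feasible μ M A) :
    totalProfit μ ψ A ≤ SigmaOpt μ ψ M := by
  refine le_csSup ⟨∑ i, ∫ x, |ψ i x| ∂μ, ?_⟩ ⟨A, hA, rfl⟩
  rintro _ ⟨B, -, rfl⟩
  refine Finset.sum_le_sum fun i _ => ?_
  calc ∫ x in B i, ψ i x ∂μ ≤ ∫ x in B i, |ψ i x| ∂μ :=
        integral_mono (hψ i).integrableOn (hψ i).abs.integrableOn fun x => le_abs_self _
    _ ≤ ∫ x, |ψ i x| ∂μ :=
        setIntegral_le_integral (hψ i).abs (ae_of_all _ fun x => abs_nonneg _)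

/-- Theorem `new` (i): if the new wisdom of agent 1 satisfies
`ψ̃₁ ≥ β ψ₁` with `β > 1`, then `P̃₁ ≥ (β − 1) P̄₁`. -/
theorem individual_value_lower_bound
    {X : Type*} [TopologicalSpace X] [CompactSpace X] [T2Space X]
    [MeasurableSpace X] [BorelSpace X]
    (μ : Measure X) [IsProbabilityMeasure μ]
    {N : ℕ}
    (ψ : Fin (N + 1) → X → ℝ) (hψc : ∀ i, Continuous (ψ i))
    (hpos : ∀ i, μ {x | ψ i x ≤ 0} = 0)
    (htwist : ∀ i j, i ≠ j → ∀ r : ℝ, μ {x | ψ i x - ψ j x = r} = 0)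
    (M : Fin (N + 1) → ℝ) (hM : ∀ i, 0 < M i)
    (β : ℝ) (hβ : 1 < β)
    (ψt : Fin (N + 1) → X → ℝ) (hψtc : ∀ i, Continuous (ψt i))
    (hkeep : ∀ i, i ≠ 0 → ψt i = ψ i)
    (hge : ∀ x, β * ψ 0 x ≤ ψt 0 x)
    (hpos' : ∀ i, μ {x | ψt i x ≤ 0} = 0)
    (htwist' : ∀ i j, i ≠ j → ∀ r : ℝ, μ {x | ψt i x - ψt j x = r} = 0)
    (Abar Atil : Fin (N + 1) → Set X)
    (hAbarF : Feasible μ M Abar) (hAbarOpt : totalProfit μ ψ Abar = SigmaOpt μ ψ M)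
    (hAtilF : Feasible μ M Atil) (hAtilOpt : totalProfit μ ψt Atil = SigmaOpt μ ψt M) :
    (β - 1) * ∫ x in Abar 0, ψ 0 x ∂μ ≤ ∫ x in Atil 0, ψt 0 x ∂μ := by
  have hψi : ∀ i, Integrable (ψ i) μ := fun i =>
    (hψc i).integrable_of_hasCompactSupport (HasCompactSupport.of_compactSpace _)
  have hψti : ∀ i, Integrable (ψt i) μ := fun i =>
    (hψtc i).integrable_of_hasCompactSupport (HasCompactSupport.of_compactSpace _)
  have hbar := hAbarOpt ▸ le_SigmaOpt hψi hAtilF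
  have htil := hAtilOpt ▸ le_SigmaOpt hψti hAbarF
  have hsplit : ∀ A : Fin (N + 1) → Set X,
      ∑ i : Fin N, ∫ x in A i.succ, ψt i.succ x ∂μ = ∑ i : Fin N, ∫ x in A i.succ, ψ i.succ x ∂μ :=
    fun A => Finset.sum_congr rfl fun i _ => by rw [hkeep _ i.succ_ne_zero]
  simp only [totalProfit, Fin.sum_univ_succ, hsplit] at hbar htil
  have hscale : β * ∫ x in Abar 0, ψ 0 x ∂μ ≤ ∫ x in Abar 0, ψt 0 x ∂μ := by
    rw [← integral_const_mul]
    exact integral_mono ((hψi 0).const_mul β).integrableOn (hψti 0).integrableOn hge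
  have hnonneg : 0 ≤ ∫ x in Atil 0, ψ 0 x ∂μ := by
    have hae : ∀ᵐ x ∂μ, 0 ≤ ψ 0 x := by
      have : ∀ᵐ x ∂μ, ¬ ψ 0 x ≤ 0 := by
        rw [ae_iff]
        simpa only [not_not] using hpos 0
      filter_upwards [this] with x hx using (not_le.mp hx).le
    exact integral_nonneg_of_ae (ae_restrict_of_ae hae)
  linarith
end

section
/- Sharpness of the lower bound P̃_1 ≥ (β−1)P̄_1: for every β > 2 and every s > β − 1 there exist a compact metric space X, a Borel probability measure μ on X, a number N = 2 of agents, continuous wisdoms ψ_1, ψ_2 : X → ℝ and ψ̃_1 : X → ℝ with ψ̃_1(x) ≥ β ψ_1(x) for all x ∈ X, and capacities M_1, M_2 > 0, such that both systems (ψ_1, ψ_2) and (ψ̃_1, ψ_2) satisfy assumptions (i) and (ii), and the individual values satisfy P̃_1 < s P̄_1. -/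
open MeasureTheory

lemma setIntegral_sub_sub_const {X : Type*} [MeasurableSpace X] {μ : Measure X}
    [IsFiniteMeasure μ] {f g : X → ℝ} (hf : Integrable f μ) (hg : Integrable g μ) (q : ℝ)
    (S : Set X) :
    ∫ x in S, (f x - g x - q) ∂μ = ∫ x in S, f x ∂μ - ∫ x in S, g x ∂μ - μ.real S * q := by
  have h : IntegrableOn (fun x => f x - g x) S μ := (hf.sub hg).integrableOn
  rw [integral_sub h (integrable_const q), integral_sub hf.integrableOn hg.integrableOn]
  simp

/-- Twisted by a price `q`, the profit of a feasible pair is controlled by the first set alone. -/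
lemma totalProfit_pair_le {X : Type*} [MeasurableSpace X] {μ : Measure X} [IsFiniteMeasure μ]
    {f g : X → ℝ} (hf : Integrable f μ) (hg : Integrable g μ) (hg0 : ∀ x, 0 ≤ g x)
    {m m' q : ℝ} (hm : 0 ≤ m) (hq : 0 ≤ q) {A : Fin 2 → Set X} (hA : Feasible μ ![m, m'] A) :
    totalProfit μ ![f, g] A ≤
      ∫ x, g x ∂μ + ∫ x, (A 0).indicator (fun x => f x - g x - q) x ∂μ + q * m := by
  obtain ⟨hmeas, hcap, hdisj⟩ := hA
  have hsub : A 1 ≤ᵐ[μ] ((A 0)ᶜ : Set X) := by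
    have h0 : μ (A 0 ∩ A 1) = 0 := hdisj (by decide)
    filter_upwards [measure_eq_zero_iff_ae_notMem.mp h0] with x hx h1 h2
    exact hx ⟨h2, h1⟩
  have h1 : ∫ x in A 1, g x ∂μ ≤ ∫ x in (A 0)ᶜ, g x ∂μ :=
    setIntegral_mono_set hg.integrableOn (.of_forall hg0) hsub
  have h2 := integral_add_compl (hmeas 0) hg
  have h3 := setIntegral_sub_sub_const hf hg q (A 0)
  have h4 : μ.real (A 0) ≤ m := ENNReal.toReal_le_of_le_ofReal hm (hcap 0)
  rw [integral_indicator (hmeas 0), h3]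
  simp only [totalProfit, Fin.sum_univ_two, Matrix.cons_val_zero, Matrix.cons_val_one]
  nlinarith

lemma totalProfit_compl {X : Type*} [MeasurableSpace X] {μ : Measure X} [IsFiniteMeasure μ]
    {f g : X → ℝ} (hf : Integrable f μ) (hg : Integrable g μ) (q : ℝ)
    {B : Set X} (hB : MeasurableSet B) :
    totalProfit μ ![f, g] ![B, Bᶜ] =
      ∫ x, g x ∂μ + ∫ x, B.indicator (fun x => f x - g x - q) x ∂μ + q * μ.real B := by
  have h2 := integral_add_compl hB hg
  have h3 := setIntegral_sub_sub_const hf hg q B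
  rw [integral_indicator hB, h3]
  simp only [totalProfit, Fin.sum_univ_two, Matrix.cons_val_zero, Matrix.cons_val_one]
  linarith

lemma indicator_ae_le_indicator {X : Type*} [MeasurableSpace X] {μ : Measure X} {k : X → ℝ}
    {B : Set X} (hpos : ∀ᵐ x ∂μ, x ∈ B → 0 < k x) (hneg : ∀ᵐ x ∂μ, x ∉ B → k x < 0) (A : Set X) :
    A.indicator k ≤ᵐ[μ] B.indicator k := by
  filter_upwards [hpos, hneg] with x h1 h2
  by_cases hA : x ∈ A <;> by_cases hB : x ∈ B <;> simp [hA, hB]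
  · exact (h2 hB).le
  · exact (h1 hB).le

/-- If the superlevel set `B` of `f - g` at a nonnegative price exactly fills the first capacity,
then `(B, Bᶜ)` is optimal, and every optimal pair has first set `B` up to a null set. -/
lemma optimal_pair_of_threshold {X : Type*} [MeasurableSpace X] {μ : Measure X}
    [IsProbabilityMeasure μ] {f g : X → ℝ} (hf : Integrable f μ) (hg : Integrable g μ)
    (hg0 : ∀ x, 0 ≤ g x) {m q : ℝ} (hm : 0 ≤ m) (hq : 0 ≤ q) {B : Set X} (hB : MeasurableSet B)
    (hBm : μ B = ENNReal.ofReal m) (hpos : ∀ᵐ x ∂μ, x ∈ B → q < f x - g x)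
    (hneg : ∀ᵐ x ∂μ, x ∉ B → f x - g x < q) :
    (∃ A, Feasible μ ![m, 1 - m] A ∧
      totalProfit μ ![f, g] A = SigmaOpt μ ![f, g] ![m, 1 - m]) ∧
    ∀ A, Feasible μ ![m, 1 - m] A →
      totalProfit μ ![f, g] A = SigmaOpt μ ![f, g] ![m, 1 - m] → A 0 =ᵐ[μ] B := by
  set k : X → ℝ := fun x => f x - g x - q
  have hki : Integrable k μ := (hf.sub hg).sub (integrable_const q)
  have hkpos : ∀ᵐ x ∂μ, x ∈ B → 0 < k x := by
    filter_upwards [hpos] with x h hx using sub_pos.2 (h hx)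
  have hkneg : ∀ᵐ x ∂μ, x ∉ B → k x < 0 := by
    filter_upwards [hneg] with x h hx using sub_neg.2 (h hx)
  have hBr : μ.real B = m := by rw [measureReal_def, hBm, ENNReal.toReal_ofReal hm]
  have hfeas : Feasible μ ![m, 1 - m] ![B, Bᶜ] := by
    refine ⟨fun i => ?_, fun i => ?_, fun i j hij => ?_⟩
    · fin_cases i
      exacts [hB, hB.compl]
    · fin_cases i
      · exact hBm.le
      · change μ Bᶜ ≤ ENNReal.ofReal (1 - m)
        rw [prob_compl_eq_one_sub hB, hBm, ENNReal.ofReal_sub _ hm, ENNReal.ofReal_one]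
    · fin_cases i <;> fin_cases j <;> simp at hij ⊢
  have hprofit := totalProfit_compl hf hg q hB
  rw [hBr] at hprofit
  have hle (A : Fin 2 → Set X) (hA : Feasible μ ![m, 1 - m] A) :
      ∫ x, (A 0).indicator k x ∂μ ≤ ∫ x, B.indicator k x ∂μ :=
    integral_mono_ae (hki.indicator (hA.1 0)) (hki.indicator hB)
      (indicator_ae_le_indicator hkpos hkneg _)
  have hmax : IsGreatest {s | ∃ A, Feasible μ ![m, 1 - m] A ∧ s = totalProfit μ ![f, g] A}
      (totalProfit μ ![f, g] ![B, Bᶜ]) := by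
    refine ⟨⟨_, hfeas, rfl⟩, ?_⟩
    rintro _ ⟨A, hA, rfl⟩
    have := totalProfit_pair_le hf hg hg0 hm hq hA
    have := hle A hA
    linarith
  have hopt : SigmaOpt μ ![f, g] ![m, 1 - m] = totalProfit μ ![f, g] ![B, Bᶜ] := hmax.csSup_eq
  refine ⟨⟨_, hfeas, hopt.symm⟩, fun A hA hAopt => ?_⟩
  have h1 := totalProfit_pair_le hf hg hg0 hm hq hA
  have h2 := hle A hA
  have heq : ∫ x, (A 0).indicator k x ∂μ = ∫ x, B.indicator k x ∂μ := by
    refine le_antisymm h2 ?_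
    rw [hAopt, hopt] at h1
    linarith
  have hae := (integral_eq_iff_of_ae_le (hki.indicator (hA.1 0)) (hki.indicator hB)
    (indicator_ae_le_indicator hkpos hkneg _)).1 heq
  filter_upwards [hae, hkpos, hkneg] with x hx hp hn
  refine propext ⟨fun hxA => ?_, fun hxB => ?_⟩
  · by_contra hxB
    have := hn hxB
    rw [Set.indicator_of_mem hxA, Set.indicator_of_notMem hxB] at hx
    linarith
  · by_contra hxA
    have := hp hxB
    rw [Set.indicator_of_notMem hxA, Set.indicator_of_mem hxB] at hx
    linarith

/-- Nonconstant affine functions on the unit interval have null level sets. -/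
lemma unitInterval_volume_affine_level {a b : ℝ} (hb : b ≠ 0) {f : unitInterval → ℝ}
    (hf : ∀ x : unitInterval, f x = a + b * x) (r : ℝ) :
    (volume : Measure unitInterval) {x | f x = r} = 0 := by
  refine Set.Subsingleton.measure_zero (fun x hx y hy => Subtype.ext ?_) _
  simp only [Set.mem_ofPred_eq, hf] at hx hy
  exact mul_left_cancel₀ hb (by linarith)

/-- Theorem `new` (ii): sharpness of the bound `P̃₁ ≥ (β−1) P̄₁`. -/
theorem individual_value_lower_bound_sharp
    (β s : ℝ) (hβ : 2 < β) (hs : β - 1 < s) :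
    ∃ (X : Type) (_ : MetricSpace X) (_ : CompactSpace X)
      (_ : MeasurableSpace X) (_ : BorelSpace X)
      (μ : Measure X) (_ : IsProbabilityMeasure μ)
      (ψ₁ ψ₂ ψt : X → ℝ) (M₁ M₂ : ℝ),
      Continuous ψ₁ ∧ Continuous ψ₂ ∧ Continuous ψt ∧
      (∀ x, β * ψ₁ x ≤ ψt x) ∧
      0 < M₁ ∧ 0 < M₂ ∧
      μ {x | ψ₁ x ≤ 0} = 0 ∧ μ {x | ψ₂ x ≤ 0} = 0 ∧ μ {x | ψt x ≤ 0} = 0 ∧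
      (∀ r : ℝ, μ {x | ψ₁ x - ψ₂ x = r} = 0) ∧
      (∀ r : ℝ, μ {x | ψt x - ψ₂ x = r} = 0) ∧
      (∃ A, Feasible μ ![M₁, M₂] A ∧
        totalProfit μ ![ψ₁, ψ₂] A = SigmaOpt μ ![ψ₁, ψ₂] ![M₁, M₂]) ∧
      (∃ A, Feasible μ ![M₁, M₂] A ∧
        totalProfit μ ![ψt, ψ₂] A = SigmaOpt μ ![ψt, ψ₂] ![M₁, M₂]) ∧
      (∀ Abar Atil : Fin 2 → Set X,
        Feasible μ ![M₁, M₂] Abar →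
        totalProfit μ ![ψ₁, ψ₂] Abar = SigmaOpt μ ![ψ₁, ψ₂] ![M₁, M₂] →
        Feasible μ ![M₁, M₂] Atil →
        totalProfit μ ![ψt, ψ₂] Atil = SigmaOpt μ ![ψt, ψ₂] ![M₁, M₂] →
        ∫ x in Atil 0, ψt x ∂μ < s * ∫ x in Abar 0, ψ₁ x ∂μ) := by
  obtain ⟨η, hη0, hη1, hηs⟩ : ∃ η : ℝ, 0 < η ∧ η ≤ 1 / 2 ∧ 2 * η ≤ s - β + 1 :=
    ⟨min (1 / 2) ((s - β + 1) / 2), lt_min (by norm_num) (by linarith), min_le_left _ _,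
      by linarith [min_le_right (1 / 2) ((s - β + 1) / 2)]⟩
  obtain ⟨m, hm0, hm1, hms⟩ : ∃ m : ℝ, 0 < m ∧ m < 1 ∧ m * (1 + s) < η := by
    refine ⟨η / (2 * (1 + s)), div_pos hη0 (by linarith), ?_, ?_⟩
    · rw [div_lt_one (by linarith)]; linarith
    · have : 1 + s ≠ 0 := by linarith
      field_simp
      linarith
  have hcont : Continuous fun x : unitInterval => (x : ℝ) := continuous_subtype_val
  let ψ₁ : unitInterval → ℝ := fun x => 1 - x
  let ψ₂ : unitInterval → ℝ := fun x => (1 - η / 2) * (1 - x)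
  let ψt : unitInterval → ℝ := fun x => β * (1 - x) + (β - 1 + η) * x
  have hc₁ : Continuous ψ₁ := by fun_prop
  have hc₂ : Continuous ψ₂ := by fun_prop
  have hct : Continuous ψt := by fun_prop
  have hint {f : unitInterval → ℝ} (hf : Continuous f) : Integrable f volume :=
    integrableOn_univ.1 (hf.continuousOn.integrableOn_compact isCompact_univ)
  have hψ₂ (x : unitInterval) : 0 ≤ ψ₂ x :=
    mul_nonneg (by linarith) (sub_nonneg.2 x.2.2)
  have hψt (x : unitInterval) : 0 < ψt x := by
    change 0 < β * (1 - (x : ℝ)) + (β - 1 + η) * x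
    nlinarith [x.2.1, x.2.2]
  let xm : unitInterval := ⟨m, hm0.le, hm1.le⟩
  have hB₁ : volume (Set.Iio xm) = ENNReal.ofReal m := unitInterval.volume_Iio xm
  have hBt : volume (Set.Ioi (unitInterval.symm xm)) = ENNReal.ofReal m := by
    simp [xm]
  have hreal {B : Set unitInterval} (h : volume B = ENNReal.ofReal m) : volume.real B = m := by
    rw [measureReal_def, h, ENNReal.toReal_ofReal hm0.le]
  have hne (z : unitInterval) : ∀ᵐ x : unitInterval, x ≠ z := by
    simp [ae_iff]
  obtain ⟨hex₁, huniq₁⟩ := optimal_pair_of_threshold (hint hc₁) (hint hc₂) hψ₂ hm0.le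
    (q := η / 2 * (1 - m)) (mul_nonneg (by linarith) (by linarith)) measurableSet_Iio hB₁
    (.of_forall fun x hx => by
      have hx' : (x : ℝ) < m := hx
      simp only [ψ₁, ψ₂]
      nlinarith)
    (by
      filter_upwards [hne xm] with x hx hxB
      have hx' : m < (x : ℝ) := lt_of_le_of_ne (not_lt.1 hxB) fun h => hx (Subtype.ext h.symm)
      simp only [ψ₁, ψ₂]
      nlinarith)
  obtain ⟨hext, huniqt⟩ := optimal_pair_of_threshold (hint hct) (hint hc₂) hψ₂ hm0.le
    (q := (β - 1 + η / 2) + η / 2 * (1 - m)) (by nlinarith) measurableSet_Ioi hBt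
    (.of_forall fun x hx => by
      have hx' : 1 - m < (x : ℝ) := hx
      simp only [ψt, ψ₂]
      nlinarith)
    (by
      filter_upwards [hne (unitInterval.symm xm)] with x hx hxB
      have hx' : (x : ℝ) < 1 - m := lt_of_le_of_ne (not_lt.1 hxB) fun h => hx (Subtype.ext h)
      simp only [ψt, ψ₂]
      nlinarith)
  have hnull : volume {x : unitInterval | 1 - (x : ℝ) = 0} = 0 :=
    unitInterval_volume_affine_level (a := 1) (b := -1) (by norm_num) (fun x => by ring) 0
  refine ⟨unitInterval, inferInstance, inferInstance, inferInstance, inferInstance, volume,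
    inferInstance, ψ₁, ψ₂, ψt, m, 1 - m, hc₁, hc₂, hct, fun x => ?_, hm0, by linarith,
    ?_, ?_, ?_, ?_, ?_, hex₁, hext, fun Abar Atil hA hAopt hT hTopt => ?_⟩
  · have := mul_nonneg (show 0 ≤ β - 1 + η by linarith) x.2.1
    simp only [ψ₁, ψt]
    linarith
  · refine measure_mono_null (fun x (hx : 1 - (x : ℝ) ≤ 0) => ?_) hnull
    exact le_antisymm hx (sub_nonneg.2 x.2.2)
  · refine measure_mono_null (fun x (hx : (1 - η / 2) * (1 - (x : ℝ)) ≤ 0) => ?_) hnull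
    refine le_antisymm ?_ (sub_nonneg.2 x.2.2)
    exact nonpos_of_mul_nonpos_right hx (by linarith)
  · exact measure_mono_null (fun x hx => (hψt x).not_ge hx) measure_empty
  · exact unitInterval_volume_affine_level (a := η / 2) (b := -(η / 2)) (by linarith)
      fun x => by simp only [ψ₁, ψ₂]; ring
  · exact unitInterval_volume_affine_level (a := β - 1 + η / 2) (b := η / 2) (by linarith)
      fun x => by simp only [ψt, ψ₂]; ring
  · rw [setIntegral_congr_set (huniq₁ Abar hA hAopt), setIntegral_congr_set (huniqt Atil hT hTopt)]
    have hlow : (1 - m) * m ≤ ∫ x in Set.Iio xm, ψ₁ x := by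
      have := setIntegral_ge_of_const_le_real (f := ψ₁) (c := 1 - m) measurableSet_Iio
        (measure_ne_top volume (Set.Iio xm)) (fun x hx => ?_) (hint hc₁).integrableOn
      · rwa [hreal hB₁] at this
      · have hx' : (x : ℝ) < m := hx
        simp only [ψ₁]
        linarith
    have hupp : ∫ x in Set.Ioi (unitInterval.symm xm), ψt x ≤ (β - 1 + η + m) * m := by
      have := setIntegral_mono_on (g := fun _ => β - 1 + η + m) (hint hct).integrableOn
        (integrable_const _) (measurableSet_Ioi (a := unitInterval.symm xm)) fun x hx => ?_
      · rwa [setIntegral_const, hreal hBt, smul_eq_mul, mul_comm] at this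
      · have hx' : 1 - m < (x : ℝ) := hx
        simp only [ψt]
        nlinarith
    have hs0 : 0 < s := by linarith
    calc _ ≤ (β - 1 + η + m) * m := hupp
      _ < s * ((1 - m) * m) := by
        have : β - 1 + η + m < s * (1 - m) := by linarith
        nlinarith
      _ ≤ _ := mul_le_mul_of_nonneg_left hlow hs0.le
end

section
/- Sharpness of the bound P̃_1 ≥ P̄_1 − M_1 λ(2−β)/(β−1): for every 1 < β < 2, every λ > 0 and every s < λ(2−β)/(β−1), there exist a compact metric space X, a Borel probability measure μ on X, a number N = 2 of agents, continuous wisdoms ψ_1, ψ_2 : X → ℝ and ψ̃_1 : X → ℝ with β ψ_1(x) ≤ ψ̃_1(x) ≤ β ψ_1(x) + λ for all x ∈ X, and capacities M_1, M_2 > 0 with M_1 + M_2 ≤ μ(X), such that both systems (ψ_1, ψ_2) and (ψ̃_1, ψ_2) satisfy assumptions (i) and (ii), and the individual values satisfy P̃_1 < P̄_1 − M_1 s. -/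
open MeasureTheory

section TwoAgents

variable {X : Type*} [MeasurableSpace X] {μ : Measure X}

/-- The surplus over prices `p`, `q` collected by two agents from the sets `S`, `T`. -/
noncomputable def surplus (ψ₁ ψ₂ : X → ℝ) (p q : ℝ) (S T : Set X) (x : X) : ℝ :=
  S.indicator (fun x => ψ₁ x - p) x + T.indicator (fun x => ψ₂ x - q) x

theorem integrable_surplus [IsFiniteMeasure μ] {ψ₁ ψ₂ : X → ℝ} {p q : ℝ} {S T : Set X}
    (h₁ : Integrable ψ₁ μ) (h₂ : Integrable ψ₂ μ) (hS : MeasurableSet S)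
    (hT : MeasurableSet T) : Integrable (surplus ψ₁ ψ₂ p q S T) μ :=
  ((h₁.sub (integrable_const p)).indicator hS).add ((h₂.sub (integrable_const q)).indicator hT)

theorem totalProfit_eq_integral_surplus [IsFiniteMeasure μ] {ψ₁ ψ₂ : X → ℝ} (p q : ℝ)
    {A : Fin 2 → Set X} (h₁ : Integrable ψ₁ μ) (h₂ : Integrable ψ₂ μ)
    (hA : ∀ i, MeasurableSet (A i)) :
    totalProfit μ ![ψ₁, ψ₂] A =
      ∫ x, surplus ψ₁ ψ₂ p q (A 0) (A 1) x ∂μ + p * μ.real (A 0) + q * μ.real (A 1) := by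
  have hs : ∫ x, surplus ψ₁ ψ₂ p q (A 0) (A 1) x ∂μ =
      ∫ x in A 0, (ψ₁ x - p) ∂μ + ∫ x in A 1, (ψ₂ x - q) ∂μ := by
    rw [← integral_indicator (hA 0), ← integral_indicator (hA 1)]
    exact integral_add ((h₁.sub (integrable_const p)).indicator (hA 0))
      ((h₂.sub (integrable_const q)).indicator (hA 1))
  rw [hs, integral_sub h₁.integrableOn (integrable_const p),
    integral_sub h₂.integrableOn (integrable_const q)]
  simp [totalProfit, Fin.sum_univ_two]
  ring

/-- If at positive prices `p`, `q` the set `H` strictly prefers agent `1`, its complement strictly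
prefers agent `2`, and both clear the capacities, then `(H, Hᶜ)` is optimal and agent `1` gets `H`
in every optimal partition. -/
theorem optimal_of_clearing_prices [IsProbabilityMeasure μ] {ψ₁ ψ₂ : X → ℝ} {p q M₁ M₂ : ℝ}
    {H : Set X} (h₁ : Integrable ψ₁ μ) (h₂ : Integrable ψ₂ μ) (hH : MeasurableSet H)
    (hp : 0 ≤ p) (hq : 0 ≤ q) (hM₁ : 0 ≤ M₁) (hM₂ : 0 ≤ M₂)
    (hμ₁ : μ H = ENNReal.ofReal M₁) (hμ₂ : μ Hᶜ = ENNReal.ofReal M₂) (hψ₂ : ∀ x, q < ψ₂ x)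
    (hpref : ∀ᵐ x ∂μ, (x ∈ H → ψ₂ x - q < ψ₁ x - p) ∧ (x ∉ H → ψ₁ x - p < ψ₂ x - q)) :
    (Feasible μ ![M₁, M₂] ![H, Hᶜ] ∧
      totalProfit μ ![ψ₁, ψ₂] ![H, Hᶜ] = SigmaOpt μ ![ψ₁, ψ₂] ![M₁, M₂]) ∧
    ∀ A, Feasible μ ![M₁, M₂] A →
      totalProfit μ ![ψ₁, ψ₂] A = SigmaOpt μ ![ψ₁, ψ₂] ![M₁, M₂] → A 0 =ᵐ[μ] H := by
  have hfeas : Feasible μ ![M₁, M₂] ![H, Hᶜ] := by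
    refine ⟨?_, ?_, ?_⟩
    · intro i; fin_cases i
      · exact hH
      · exact hH.compl
    · intro i; fin_cases i
      · exact hμ₁.le
      · exact hμ₂.le
    · intro i j hij
      fin_cases i <;> fin_cases j <;> simp at hij ⊢
  have hprofit := totalProfit_eq_integral_surplus p q h₁ h₂ hfeas.1
  simp only [Matrix.cons_val_zero, Matrix.cons_val_one, measureReal_def, hμ₁, hμ₂,
    ENNReal.toReal_ofReal hM₁, ENNReal.toReal_ofReal hM₂] at hprofit
  have hpt : ∀ A, Feasible μ ![M₁, M₂] A → ∀ᵐ x ∂μ,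
      surplus ψ₁ ψ₂ p q (A 0) (A 1) x ≤ surplus ψ₁ ψ₂ p q H Hᶜ x ∧
      (surplus ψ₁ ψ₂ p q (A 0) (A 1) x = surplus ψ₁ ψ₂ p q H Hᶜ x → (x ∈ A 0 ↔ x ∈ H)) := by
    intro A hA
    have hdisj : ∀ᵐ x ∂μ, x ∉ A 0 ∩ A 1 := measure_eq_zero_iff_ae_notMem.1 (hA.2.2 (by simp))
    filter_upwards [hdisj, hpref] with x hx hx'
    replace hψ₂ := hψ₂ x
    by_cases hxH : x ∈ H <;> by_cases hx0 : x ∈ A 0 <;> by_cases hx1 : x ∈ A 1 <;>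
      simp_all [surplus] <;> first | linarith | (constructor <;> linarith)
  have hle : ∀ A, Feasible μ ![M₁, M₂] A →
      totalProfit μ ![ψ₁, ψ₂] A ≤ ∫ x, surplus ψ₁ ψ₂ p q (A 0) (A 1) x ∂μ + p * M₁ + q * M₂ := by
    intro A hA
    rw [totalProfit_eq_integral_surplus p q h₁ h₂ hA.1]
    have h0 : μ.real (A 0) ≤ M₁ := ENNReal.toReal_le_of_le_ofReal hM₁ (hA.2.1 0)
    have h1 : μ.real (A 1) ≤ M₂ := ENNReal.toReal_le_of_le_ofReal hM₂ (hA.2.1 1)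
    gcongr
  have hH_int : Integrable (surplus ψ₁ ψ₂ p q H Hᶜ) μ := integrable_surplus h₁ h₂ hH hH.compl
  have hA_int : ∀ A, Feasible μ ![M₁, M₂] A →
      Integrable (surplus ψ₁ ψ₂ p q (A 0) (A 1)) μ :=
    fun A hA => integrable_surplus h₁ h₂ (hA.1 0) (hA.1 1)
  have hopt : SigmaOpt μ ![ψ₁, ψ₂] ![M₁, M₂] = totalProfit μ ![ψ₁, ψ₂] ![H, Hᶜ] := by
    refine IsGreatest.csSup_eq ⟨⟨_, hfeas, rfl⟩, ?_⟩
    rintro _ ⟨A, hA, rfl⟩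
    have := integral_mono_ae (hA_int A hA) hH_int ((hpt A hA).mono fun x hx => hx.1)
    linarith [hle A hA]
  refine ⟨⟨hfeas, hopt.symm⟩, fun A hA hAopt => ?_⟩
  have hge := hle A hA
  have hmono := (hpt A hA).mono fun x hx => hx.1
  have heq : ∫ x, surplus ψ₁ ψ₂ p q (A 0) (A 1) x ∂μ = ∫ x, surplus ψ₁ ψ₂ p q H Hᶜ x ∂μ :=
    le_antisymm (integral_mono_ae (hA_int A hA) hH_int hmono) (by linarith)
  have hae := (integral_eq_iff_of_ae_le (hA_int A hA) hH_int hmono).1 heq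
  filter_upwards [hpt A hA, hae] with x hx hx'
  exact propext (hx.2 hx')

end TwoAgents

/-- A nonatomic probability measure on `[0, 1]` that lives within `ε` of the endpoints and splits
its mass evenly between them. -/
theorem exists_measure_near_endpoints {ε : ℝ} (hε : 0 < ε) (hε' : ε < 1 / 2) :
    ∃ μ : Measure unitInterval, IsProbabilityMeasure μ ∧
      (∀ r : ℝ, ∀ᵐ x : unitInterval ∂μ, (x : ℝ) ≠ r) ∧
      (∀ᵐ x : unitInterval ∂μ, (x : ℝ) ≤ ε ∨ 1 - ε ≤ (x : ℝ)) ∧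
      μ {x | (x : ℝ) ≤ 1 / 2} = ENNReal.ofReal (1 / 2) ∧
      μ {x | (x : ℝ) ≤ 1 / 2}ᶜ = ENNReal.ofReal (1 / 2) := by
  let a : unitInterval := ⟨ε, by constructor <;> linarith⟩
  let b : unitInterval := ⟨1 - ε, by constructor <;> linarith⟩
  let S : Set unitInterval := Set.Iic a ∪ Set.Ici b
  have hS : MeasurableSet S := measurableSet_Iic.union measurableSet_Ici
  have hvol : volume S = ENNReal.ofReal (2 * ε) := by
    rw [measure_union _ measurableSet_Ici, unitInterval.volume_Iic, unitInterval.volume_Ici,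
      ← ENNReal.ofReal_add hε.le (by simp [b, hε.le])]
    · congr 1; simp only [b]; ring
    · rw [Set.disjoint_left]
      intro x hx hx'
      have h1 : (x : ℝ) ≤ ε := hx
      have h2 : 1 - ε ≤ (x : ℝ) := hx'
      linarith
  have hS0 : volume S ≠ 0 := by rw [hvol]; simpa using hε
  have := ProbabilityTheory.cond_isProbabilityMeasure hS0
  have hL : MeasurableSet {x : unitInterval | (x : ℝ) ≤ 1 / 2} :=
    measurableSet_le measurable_subtype_coe measurable_const
  have hhalf : ProbabilityTheory.cond volume S {x : unitInterval | (x : ℝ) ≤ 1 / 2} =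
      ENNReal.ofReal (1 / 2) := by
    have hinter : S ∩ {x : unitInterval | (x : ℝ) ≤ 1 / 2} = Set.Iic a := by
      ext x
      constructor
      · rintro ⟨hx | hx, h⟩
        · exact hx
        · have h1 : 1 - ε ≤ (x : ℝ) := hx
          have h2 : (x : ℝ) ≤ 1 / 2 := h
          linarith
      · intro hx
        have h1 : (x : ℝ) ≤ ε := hx
        exact ⟨Or.inl hx, show (x : ℝ) ≤ 1 / 2 by linarith⟩
    rw [ProbabilityTheory.cond_apply hS, hinter, hvol, unitInterval.volume_Iic,
      ← ENNReal.ofReal_inv_of_pos (by positivity), ← ENNReal.ofReal_mul (by positivity)]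
    congr 1
    simp only [a]
    field_simp
  refine ⟨ProbabilityTheory.cond volume S, this, fun r => ?_, ?_, hhalf, ?_⟩
  · have hr : {x : unitInterval | (x : ℝ) = r}.Subsingleton := fun x hx y hy =>
      Subtype.ext (Eq.trans (b := r) hx (Eq.symm hy))
    exact ProbabilityTheory.cond_absolutelyContinuous.ae_le
      (measure_eq_zero_iff_ae_notMem.1 (hr.measure_zero volume))
  · exact ProbabilityTheory.ae_cond_mem hS
  · rw [prob_compl_eq_one_sub hL, hhalf, ← ENNReal.ofReal_one, ← ENNReal.ofReal_sub _ (by norm_num)]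
    norm_num

/-- Theorem `new1` (ii): sharpness of the bound
`P̃₁ ≥ P̄₁ − M₁ λ(2−β)/(β−1)`. -/
theorem individual_value_decrease_bound_sharp
    (β lam s : ℝ) (hβ₁ : 1 < β) (hβ₂ : β < 2) (hlam : 0 < lam)
    (hs : s < lam * (2 - β) / (β - 1)) :
    ∃ (X : Type) (_ : MetricSpace X) (_ : CompactSpace X)
      (_ : MeasurableSpace X) (_ : BorelSpace X)
      (μ : Measure X) (_ : IsProbabilityMeasure μ)
      (ψ₁ ψ₂ ψt : X → ℝ) (M₁ M₂ : ℝ),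
      Continuous ψ₁ ∧ Continuous ψ₂ ∧ Continuous ψt ∧
      (∀ x, β * ψ₁ x ≤ ψt x) ∧ (∀ x, ψt x ≤ β * ψ₁ x + lam) ∧
      0 < M₁ ∧ 0 < M₂ ∧ M₁ + M₂ ≤ 1 ∧
      μ {x | ψ₁ x ≤ 0} = 0 ∧ μ {x | ψ₂ x ≤ 0} = 0 ∧ μ {x | ψt x ≤ 0} = 0 ∧
      (∀ r : ℝ, μ {x | ψ₁ x - ψ₂ x = r} = 0) ∧
      (∀ r : ℝ, μ {x | ψt x - ψ₂ x = r} = 0) ∧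
      (∃ A, Feasible μ ![M₁, M₂] A ∧
        totalProfit μ ![ψ₁, ψ₂] A = SigmaOpt μ ![ψ₁, ψ₂] ![M₁, M₂]) ∧
      (∃ A, Feasible μ ![M₁, M₂] A ∧
        totalProfit μ ![ψt, ψ₂] A = SigmaOpt μ ![ψt, ψ₂] ![M₁, M₂]) ∧
      (∀ Abar Atil : Fin 2 → Set X,
        Feasible μ ![M₁, M₂] Abar →
        totalProfit μ ![ψ₁, ψ₂] Abar = SigmaOpt μ ![ψ₁, ψ₂] ![M₁, M₂] →
        Feasible μ ![M₁, M₂] Atil →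
        totalProfit μ ![ψt, ψ₂] Atil = SigmaOpt μ ![ψt, ψ₂] ![M₁, M₂] →
        ∫ x in Atil 0, ψt x ∂μ < (∫ x in Abar 0, ψ₁ x ∂μ) - M₁ * s) := by
  set T := lam / (β - 1) with hT
  have hβ : 0 < β - 1 := by linarith
  have hTpos : 0 < T := div_pos hlam hβ
  have hTlam : T * (β - 1) = lam := div_mul_cancel₀ _ hβ.ne'
  obtain ⟨δ, hδ, hδs⟩ : ∃ δ > 0, s = T - lam - δ := by
    refine ⟨T - lam - s, ?_, by ring⟩
    have : lam * (2 - β) / (β - 1) = T - lam := by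
      rw [div_eq_iff hβ.ne', sub_mul, hTlam]; ring
    linarith
  obtain ⟨t, htT, htT', htδ⟩ : ∃ t < T, T / 2 ≤ t ∧ T - δ / 2 ≤ t :=
    ⟨T - min (δ / 2) (T / 2), by have := lt_min (half_pos hδ) (half_pos hTpos); linarith,
      by linarith [min_le_right (δ / 2) (T / 2)], by linarith [min_le_left (δ / 2) (T / 2)]⟩
  have ht : 0 < t := by linarith
  obtain ⟨w, hw, hwδ⟩ : ∃ w > 0, (β - 1) * w ≤ δ / 8 :=
    ⟨δ / 8, by positivity, by nlinarith⟩
  obtain ⟨ε, hε, hε', hεδ⟩ : ∃ ε > 0, ε < 1 / 2 ∧ (1 + β) * t * ε ≤ δ / 8 := by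
    refine ⟨min (1 / 4) (δ / 8 / ((1 + β) * t)), by positivity, ?_, ?_⟩
    · exact (min_le_left _ _).trans_lt (by norm_num)
    · have h0 : 0 < (1 + β) * t := by positivity
      calc _ ≤ (1 + β) * t * (δ / 8 / ((1 + β) * t)) := by gcongr; exact min_le_right _ _
        _ = δ / 8 := mul_div_cancel₀ _ h0.ne'
  obtain ⟨d, hd, hdt, hdβ⟩ : ∃ d > 0, d < t ∧ β * t - lam < d :=
    ⟨(t + (β * t - lam)) / 2, by nlinarith, by nlinarith, by nlinarith⟩
  obtain ⟨μ, hμ, hatom, hsupp, hlow, hhigh⟩ := exists_measure_near_endpoints hε hε'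
  let L : Set unitInterval := {x | (x : ℝ) ≤ 1 / 2}
  have hL : MeasurableSet L := measurableSet_le measurable_subtype_coe measurable_const
  have hx0 : ∀ x : unitInterval, 0 ≤ (x : ℝ) := fun x => x.2.1
  have hx1 : ∀ x : unitInterval, (x : ℝ) ≤ 1 := fun x => x.2.2
  let ψ₁ : unitInterval → ℝ := fun x => w + t * x
  let ψ₂ : unitInterval → ℝ := fun x => 2 * w + d * x
  let ψt : unitInterval → ℝ := fun x => β * (w + t * x) + lam * (1 - x)
  have hc₁ : Continuous ψ₁ := by fun_prop
  have hc₂ : Continuous ψ₂ := by fun_prop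
  have hct : Continuous ψt := by fun_prop
  have hint : ∀ f : unitInterval → ℝ, Continuous f → Integrable f μ := fun f hf =>
    hf.integrable_of_hasCompactSupport (HasCompactSupport.of_compactSpace f)
  have hpos₁ : ∀ x, 0 < ψ₁ x := fun x => by have := hx0 x; simp only [ψ₁]; positivity
  have hpos₂ : ∀ x, 0 < ψ₂ x := fun x => by have := hx0 x; simp only [ψ₂]; positivity
  have hpost : ∀ x, 0 < ψt x := fun x => by
    have := hx0 x
    have : 0 ≤ 1 - (x : ℝ) := by linarith [hx1 x]
    simp only [ψt]; positivity
  have hnull : ∀ f : unitInterval → ℝ, (∀ x, 0 < f x) → μ {x | f x ≤ 0} = 0 := fun f hf => by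
    simp [not_le.2 (hf _)]
  have hψ₂ : ∀ x, w < ψ₂ x := fun x => by
    have := mul_nonneg hd.le (hx0 x)
    simp only [ψ₂]; linarith
  have opt₁ := optimal_of_clearing_prices (μ := μ) (M₁ := 1 / 2) (M₂ := 1 / 2) (p := (t - d) / 2)
    (q := w) (H := Lᶜ) (hint ψ₁ hc₁) (hint ψ₂ hc₂) hL.compl (by linarith) hw.le
    (by norm_num) (by norm_num)
    hhigh (by rwa [compl_compl]) hψ₂ (by
      filter_upwards [hatom (1 / 2)] with x hx
      simp only [L, ψ₁, ψ₂, Set.mem_compl_iff, Set.mem_ofPred_eq, not_le]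
      constructor
      · intro h; nlinarith
      · intro h; have := lt_of_le_of_ne (not_lt.1 h) hx; nlinarith)
  have optt := optimal_of_clearing_prices (μ := μ) (M₁ := 1 / 2) (M₂ := 1 / 2)
    (p := (β - 1) * w + lam / 2 + (β * t - d) / 2) (q := w) (H := L)
    (hint ψt hct) (hint ψ₂ hc₂) hL (by nlinarith) hw.le (by norm_num) (by norm_num)
    hlow hhigh hψ₂ (by
      filter_upwards [hatom (1 / 2)] with x hx
      simp only [L, ψt, ψ₂, Set.mem_ofPred_eq, not_le]
      constructor
      · intro h; have := lt_of_le_of_ne h hx; nlinarith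
      · intro h; nlinarith)
  have hlevel : ∀ f : unitInterval → ℝ, ∀ a b : ℝ, b ≠ 0 → (∀ x, f x = a + b * x) →
      ∀ r, μ {x | f x = r} = 0 := by
    intro f a b hb hf r
    refine measure_eq_zero_iff_ae_notMem.2 ((hatom ((r - a) / b)).mono fun x hx hxr => hx ?_)
    have : f x = r := hxr
    rw [eq_div_iff hb]
    linarith [hf x]
  refine ⟨unitInterval, inferInstance, inferInstance, inferInstance, inferInstance, μ, hμ,
    ψ₁, ψ₂, ψt, 1 / 2, 1 / 2, hc₁, hc₂, hct, ?_, ?_, by norm_num, by norm_num, by norm_num,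
    hnull _ hpos₁, hnull _ hpos₂, hnull _ hpost,
    hlevel (fun x => ψ₁ x - ψ₂ x) (-w) (t - d) (by linarith) fun x => by simp only [ψ₁, ψ₂]; ring,
    hlevel (fun x => ψt x - ψ₂ x) (β * w + lam - 2 * w) (β * t - lam - d) (by linarith)
      fun x => by simp only [ψt, ψ₂]; ring,
    ⟨_, opt₁.1⟩, ⟨_, optt.1⟩, ?_⟩
  · intro x
    have := mul_nonneg hlam.le (sub_nonneg.2 (hx1 x))
    simp only [ψ₁, ψt]; linarith
  · intro x
    have := mul_nonneg hlam.le (hx0 x)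
    simp only [ψ₁, ψt]; linarith
  intro Abar Atil hbar hbar' htil htil'
  rw [setIntegral_congr_set (opt₁.2 Abar hbar hbar'), setIntegral_congr_set (optt.2 Atil htil htil')]
  have hup : ∫ x in L, ψt x ∂μ ≤ (β * w + lam + β * t * ε) / 2 := by
    have := setIntegral_mono_on_ae (μ := μ) (s := L) (f := ψt)
      (g := fun _ => β * w + lam + β * t * ε) (hint ψt hct).integrableOn integrableOn_const hL (by
        filter_upwards [hsupp] with x hx hxL
        have hxL : (x : ℝ) ≤ 1 / 2 := hxL
        have hxε : (x : ℝ) ≤ ε := hx.resolve_right fun h => by linarith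
        have h1 : β * t * x ≤ β * t * ε := by gcongr
        have h2 := mul_nonneg hlam.le (hx0 x)
        simp only [ψt]; linarith)
    refine this.trans_eq ?_
    rw [setIntegral_const, measureReal_def, hlow, ENNReal.toReal_ofReal (by norm_num), smul_eq_mul]
    ring
  have hdown : (w + t * (1 - ε)) / 2 ≤ ∫ x in Lᶜ, ψ₁ x ∂μ := by
    have := setIntegral_mono_on_ae (μ := μ) (s := Lᶜ) (f := fun _ => w + t * (1 - ε))
      (g := ψ₁) integrableOn_const (hint ψ₁ hc₁).integrableOn hL.compl (by
        filter_upwards [hsupp] with x hx hxL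
        have hxL : 1 / 2 < (x : ℝ) := not_le.1 hxL
        have hxε : 1 - ε ≤ (x : ℝ) := hx.resolve_left fun h => by linarith
        simp only [ψ₁]; gcongr)
    refine Eq.trans_le ?_ this
    rw [setIntegral_const, measureReal_def, hhigh, ENNReal.toReal_ofReal (by norm_num), smul_eq_mul]
    ring
  nlinarith
end

section
/- Let ν be a cooperative game on I = {1,…,N} with nonempty core, and let λ : 2^I → ℝ be a weak division, i.e. λ(J) ≥ 0 for every J ⊆ I and Σ_{J ⊆ I, i ∈ J} λ(J) = 1 for every i ∈ I. Then Σ_{J ⊆ I} λ(J) ν(J) ≤ ν(I). -/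
/-- Proposition `pnscI`: if the core of a cooperative game is
nonempty, then for every weak division `λ` one has `Σ_J λ(J) ν(J) ≤ ν(I)`. -/
theorem core_nonempty_weak_division_necessary
    {N : ℕ} (ν : Finset (Fin N) → ℝ) (hν0 : ν ∅ = 0)
    (hcore : ∃ x : Fin N → ℝ,
      (∑ i, x i ≤ ν Finset.univ) ∧ ∀ J : Finset (Fin N), ν J ≤ ∑ i ∈ J, x i)
    (lam : Finset (Fin N) → ℝ)
    (hlam0 : ∀ J, 0 ≤ lam J)
    (hlam1 : ∀ i : Fin N, ∑ J ∈ Finset.univ.filter (fun J : Finset (Fin N) => i ∈ J), lam J = 1) :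
    ∑ J : Finset (Fin N), lam J * ν J ≤ ν Finset.univ := by
  obtain ⟨x, hx, hJ⟩ := hcore
  calc ∑ J, lam J * ν J ≤ ∑ J, lam J * ∑ i ∈ J, x i :=
        Finset.sum_le_sum fun J _ => mul_le_mul_of_nonneg_left (hJ J) (hlam0 J)
    _ = ∑ J, ∑ i ∈ J, lam J * x i := by simp only [Finset.mul_sum]
    _ = ∑ i, ∑ J ∈ Finset.univ.filter (fun J : Finset (Fin N) => i ∈ J), lam J * x i :=
        Finset.sum_comm' (by simp)
    _ = ∑ i, x i := by simp only [← Finset.sum_mul, hlam1, one_mul]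
    _ ≤ ν Finset.univ := hx
end

section
/- Let ν be a super-additive cooperative game on I = {1,2,3}, i.e. ν(J_1) + ν(J_2) ≤ ν(J_1 ∪ J_2) whenever J_1, J_2 ⊆ I are disjoint. Then the core of ν is nonempty if and only if ν({1,2}) + ν({1,3}) + ν({2,3}) ≤ 2 ν({1,2,3}). -/
/-- A subset of a three-element set is one of the eight listed ones. -/
theorem finset_fin_three_cases (J : Finset (Fin 3)) :
    J = ∅ ∨ J = {0} ∨ J = {1} ∨ J = {2} ∨ J = {0, 1} ∨ J = {0, 2} ∨ J = {1, 2} ∨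
      J = Finset.univ := by
  revert J
  decide

/-- Corollary `corrrrr`: a super-additive cooperative game of three
players has a nonempty core iff `ν(12) + ν(13) + ν(23) ≤ 2 ν(123)`. -/
theorem three_player_core_nonempty_iff
    (ν : Finset (Fin 3) → ℝ) (hν0 : ν ∅ = 0)
    (hsuper : ∀ J₁ J₂ : Finset (Fin 3), Disjoint J₁ J₂ → ν J₁ + ν J₂ ≤ ν (J₁ ∪ J₂)) :
    (∃ x : Fin 3 → ℝ,
      (∑ i, x i ≤ ν Finset.univ) ∧ ∀ J : Finset (Fin 3), ν J ≤ ∑ i ∈ J, x i) ↔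
    ν {0, 1} + ν {0, 2} + ν {1, 2} ≤ 2 * ν Finset.univ := by
  constructor
  · rintro ⟨x, hx, hJ⟩
    have h01 := hJ {0, 1}
    have h02 := hJ {0, 2}
    have h12 := hJ {1, 2}
    rw [Finset.sum_pair (by decide)] at h01 h02 h12
    rw [Fin.sum_univ_three] at hx
    linarith
  · intro h
    have h01 : ν {0} + ν {1} ≤ ν {0, 1} := hsuper {0} {1} (by decide)
    have h0 : ν {0} + ν {1, 2} ≤ ν Finset.univ := hsuper {0} {1, 2} (by decide)
    have h1 : ν {1} + ν {0, 2} ≤ ν Finset.univ :=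
      (hsuper {1} {0, 2} (by decide)).trans_eq (congrArg ν (by decide))
    have h2 : ν {2} + ν {0, 1} ≤ ν Finset.univ :=
      (hsuper {2} {0, 1} (by decide)).trans_eq (congrArg ν (by decide))
    obtain ⟨a, ha0, ha1, ha2, ha3⟩ : ∃ a, ν {0} ≤ a ∧ a ≤ ν Finset.univ - ν {1, 2} ∧
        a ≤ ν {0, 1} - ν {1} ∧ ν {0, 1} + ν {0, 2} - ν Finset.univ ≤ a :=
      ⟨min (ν Finset.univ - ν {1, 2}) (ν {0, 1} - ν {1}),
        le_min (by linarith) (by linarith), min_le_left _ _, min_le_right _ _,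
        le_min (by linarith) (by linarith)⟩
    refine ⟨![a, ν {0, 1} - a, ν Finset.univ - ν {0, 1}], ?_, fun J => ?_⟩
    · simp [Fin.sum_univ_three]
    · rcases finset_fin_three_cases J with rfl | rfl | rfl | rfl | rfl | rfl | rfl | rfl <;>
        simp [Fin.sum_univ_three, hν0] <;> linarith
end

section
/- Let G : ℝ → ℝ be convex on [0,1] with G(0) = 0 and G(t) ≥ 0 for all t ∈ [0,1]. Let 0 < λ_1 < λ_2 < … < λ_N and let M_1, …, M_N > 0 with Σ_{i=1}^N M_i = 1. For J ⊆ I = {1,…,N} set M_J := Σ_{i∈J} M_i and define the coalition/partition game ν : 2^I → ℝ by ν(∅) := 0, ν(J) := λ_N ( G(1) − G(1 − M_J) ) if N ∈ J, and ν(J) := (max_{i ∈ J} λ_i) · G(M_J) if N ∉ J and J ≠ ∅. Then ν is super-additive: ν(J_1) + ν(J_2) ≤ ν(J_1 ∪ J_2) for all disjoint J_1, J_2 ⊆ I. -/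
/-- A convex function on `[0, 1]` vanishing at `0` is superadditive. -/
theorem ConvexOn.add_le_of_map_zero_eq_zero {G : ℝ → ℝ}
    (hG : ConvexOn ℝ (Set.Icc (0 : ℝ) 1) G) (hG0 : G 0 = 0) {a b : ℝ}
    (ha : 0 ≤ a) (hb : 0 ≤ b) (hab : a + b ≤ 1) : G a + G b ≤ G (a + b) := by
  rcases (add_nonneg ha hb).eq_or_lt with h | h
  · obtain rfl : a = 0 := by linarith
    obtain rfl : b = 0 := by linarith
    simp [hG0]
  have key : ∀ x y : ℝ, 0 ≤ x → 0 ≤ y → 0 < x + y → x + y ≤ 1 →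
      G x ≤ x / (x + y) * G (x + y) := by
    intro x y hx hy hpos hle
    have hc := hG.2 (show x + y ∈ Set.Icc (0 : ℝ) 1 from ⟨hpos.le, hle⟩)
      (show (0 : ℝ) ∈ Set.Icc (0 : ℝ) 1 from ⟨le_rfl, zero_le_one⟩)
      (show 0 ≤ x / (x + y) by positivity) (show 0 ≤ y / (x + y) by positivity)
      (by field_simp)
    simpa [hG0, div_mul_cancel₀ _ hpos.ne'] using hc
  have h₁ := key a b ha hb h hab
  have h₂ := key b a hb ha (by linarith) (by linarith)
  rw [add_comm b a] at h₂
  calc G a + G b ≤ a / (a + b) * G (a + b) + b / (a + b) * G (a + b) := add_le_add h₁ h₂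
    _ = G (a + b) := by field_simp

/-- Proposition `propmulti`: the coalition/partition game associated
with proportional wisdoms `ψ_i = λ_i ψ` (explicitly expressed through the convex
function `G = F*`) is super-additive. The agents are indexed by `Fin (N+1)`, the
wisest agent being `Fin.last N`. -/
theorem proportional_CP_game_superadditive
    {N : ℕ} (G : ℝ → ℝ)
    (hGconv : ConvexOn ℝ (Set.Icc (0 : ℝ) 1) G)
    (hG0 : G 0 = 0)
    (hGnn : ∀ t ∈ Set.Icc (0 : ℝ) 1, 0 ≤ G t)
    (l : Fin (N + 1) → ℝ) (hlpos : ∀ i, 0 < l i) (hlmono : StrictMono l)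
    (M : Fin (N + 1) → ℝ) (hM : ∀ i, 0 < M i) (hMsum : ∑ i, M i = 1)
    (ν : Finset (Fin (N + 1)) → ℝ) (hν0 : ν ∅ = 0)
    (hνtop : ∀ J : Finset (Fin (N + 1)), Fin.last N ∈ J →
      ν J = l (Fin.last N) * (G 1 - G (1 - ∑ i ∈ J, M i)))
    (hνnotop : ∀ (J : Finset (Fin (N + 1))) (hJ : J.Nonempty), Fin.last N ∉ J →
      ν J = (J.sup' hJ l) * G (∑ i ∈ J, M i)) :
    ∀ J₁ J₂ : Finset (Fin (N + 1)), Disjoint J₁ J₂ → ν J₁ + ν J₂ ≤ ν (J₁ ∪ J₂) := by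
  have hnn (J : Finset (Fin (N + 1))) : 0 ≤ ∑ i ∈ J, M i :=
    Finset.sum_nonneg fun i _ => (hM i).le
  have hle (J : Finset (Fin (N + 1))) : ∑ i ∈ J, M i ≤ 1 :=
    hMsum ▸ Finset.sum_le_univ_sum_of_nonneg fun i => (hM i).le
  have htop : ∀ J₁ J₂ : Finset (Fin (N + 1)), Disjoint J₁ J₂ → Fin.last N ∈ J₁ →
      ν J₁ + ν J₂ ≤ ν (J₁ ∪ J₂) := by
    intro J₁ J₂ hd h₁
    have h₂ : Fin.last N ∉ J₂ := Finset.disjoint_left.mp hd h₁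
    rcases J₂.eq_empty_or_nonempty with rfl | hne
    · simp [hν0]
    have hsum := Finset.sum_union hd (f := M)
    have hU := hle (J₁ ∪ J₂)
    rw [hνtop J₁ h₁, hνtop _ (Finset.mem_union_left _ h₁), hνnotop J₂ hne h₂, hsum]
    have hsup : J₂.sup' hne l ≤ l (Fin.last N) :=
      Finset.sup'_le _ _ fun i _ => hlmono.monotone (Fin.le_last i)
    have hG := mul_le_mul_of_nonneg_right hsup (hGnn _ ⟨hnn J₂, hle J₂⟩)
    have hadd := hGconv.add_le_of_map_zero_eq_zero hG0
      (a := 1 - (∑ i ∈ J₁, M i + ∑ i ∈ J₂, M i)) (by linarith) (hnn J₂)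
      (by linarith [hnn J₁])
    rw [show 1 - (∑ i ∈ J₁, M i + ∑ i ∈ J₂, M i) + ∑ i ∈ J₂, M i = 1 - ∑ i ∈ J₁, M i by ring]
      at hadd
    have hmul := mul_le_mul_of_nonneg_left hadd (hlpos (Fin.last N)).le
    linarith
  intro J₁ J₂ hd
  by_cases h₁ : Fin.last N ∈ J₁
  · exact htop J₁ J₂ hd h₁
  by_cases h₂ : Fin.last N ∈ J₂
  · rw [add_comm, Finset.union_comm]
    exact htop J₂ J₁ hd.symm h₂
  rcases J₁.eq_empty_or_nonempty with rfl | hne₁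
  · simp [hν0]
  rcases J₂.eq_empty_or_nonempty with rfl | hne₂
  · simp [hν0]
  have hsum := Finset.sum_union hd (f := M)
  have hU := hle (J₁ ∪ J₂)
  have hneU : (J₁ ∪ J₂).Nonempty := hne₁.mono Finset.subset_union_left
  rw [hνnotop J₁ hne₁ h₁, hνnotop J₂ hne₂ h₂, hνnotop _ hneU (by simp [h₁, h₂]), hsum]
  have hG₁ := mul_le_mul_of_nonneg_right
    (Finset.sup'_mono l (Finset.subset_union_left (s₂ := J₂)) hne₁)
    (hGnn _ ⟨hnn J₁, hle J₁⟩)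
  have hG₂ := mul_le_mul_of_nonneg_right
    (Finset.sup'_mono l (Finset.subset_union_right (s₁ := J₁)) hne₂)
    (hGnn _ ⟨hnn J₂, hle J₂⟩)
  have hpos : 0 ≤ (J₁ ∪ J₂).sup' hneU l := by
    obtain ⟨i, hi⟩ := hneU
    exact (hlpos i).le.trans (Finset.le_sup' l hi)
  have hmul := mul_le_mul_of_nonneg_left
    (hGconv.add_le_of_map_zero_eq_zero hG0 (hnn J₁) (hnn J₂) (hsum ▸ hU)) hpos
  linarith
end

section
/- Let G : ℝ → ℝ be convex on [0,1] with G(0) = 0 and G(t) ≥ 0 for all t ∈ [0,1]. Let 0 < λ_1 < λ_2 < λ_3 and M_1, M_2, M_3 > 0 with M_1 + M_2 + M_3 = 1. Define ν : 2^{\{1,2,3\}} → ℝ by ν(∅) := 0, ν(J) := λ_3 ( G(1) − G(1 − M_J) ) if 3 ∈ J, and ν(J) := (max_{i ∈ J} λ_i) · G(M_J) if 3 ∉ J and J ≠ ∅, where M_J := Σ_{i∈J} M_i. Then the core of ν is nonempty if and only if λ_2 G(M_1 + M_2) ≤ λ_3 ( G(M_1) + G(M_2) ). -/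
/-- A convex function on `[0, 1]` vanishing at `0` is superadditive. -/
theorem ConvexOn.add_le_map_add_of_map_zero {G : ℝ → ℝ}
    (hG : ConvexOn ℝ (Set.Icc (0 : ℝ) 1) G) (hG0 : G 0 = 0) {a b : ℝ}
    (ha : 0 < a) (hb : 0 < b) (hab : a + b ≤ 1) : G a + G b ≤ G (a + b) := by
  have hs : 0 < a + b := by positivity
  have key : ∀ c : ℝ, 0 ≤ c → c ≤ a + b → G c ≤ c / (a + b) * G (a + b) := by
    intro c hc hcs
    have h := hG.2 (Set.left_mem_Icc.2 zero_le_one) (⟨hs.le, hab⟩ : a + b ∈ Set.Icc (0 : ℝ) 1)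
      (sub_nonneg.2 ((div_le_one hs).2 hcs)) (div_nonneg hc hs.le) (sub_add_cancel _ _)
    simpa [hG0, div_mul_cancel₀ c hs.ne'] using h
  calc G a + G b ≤ a / (a + b) * G (a + b) + b / (a + b) * G (a + b) :=
        add_le_add (key a ha.le (by linarith)) (key b hb.le (by linarith))
    _ = G (a + b) := by field_simp

/-- Proposition `example1`: for the three-agent coalition/partition
game with proportional wisdoms, the core is nonempty iff
`λ₂ G(M₁+M₂) ≤ λ₃ (G(M₁) + G(M₂))`. Agents are `0, 1, 2 : Fin 3`, the wisest
being `2`. -/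
theorem three_agent_CP_game_core_nonempty_iff
    (G : ℝ → ℝ)
    (hGconv : ConvexOn ℝ (Set.Icc (0 : ℝ) 1) G)
    (hG0 : G 0 = 0)
    (hGnn : ∀ t ∈ Set.Icc (0 : ℝ) 1, 0 ≤ G t)
    (l : Fin 3 → ℝ) (hl0 : 0 < l 0) (hl01 : l 0 < l 1) (hl12 : l 1 < l 2)
    (M : Fin 3 → ℝ) (hM : ∀ i, 0 < M i) (hMsum : M 0 + M 1 + M 2 = 1)
    (ν : Finset (Fin 3) → ℝ) (hν0 : ν ∅ = 0)
    (hνtop : ∀ J : Finset (Fin 3), (2 : Fin 3) ∈ J →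
      ν J = l 2 * (G 1 - G (1 - ∑ i ∈ J, M i)))
    (hνnotop : ∀ (J : Finset (Fin 3)) (hJ : J.Nonempty), (2 : Fin 3) ∉ J →
      ν J = (J.sup' hJ l) * G (∑ i ∈ J, M i)) :
    (∃ x : Fin 3 → ℝ,
      (∑ i, x i ≤ ν Finset.univ) ∧ ∀ J : Finset (Fin 3), ν J ≤ ∑ i ∈ J, x i) ↔
    l 1 * G (M 0 + M 1) ≤ l 2 * (G (M 0) + G (M 1)) := by
  have h0 := hM 0
  have h1 := hM 1
  have h2 := hM 2
  have e1 : 1 - M 2 = M 0 + M 1 := by linarith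
  have e2 : 1 - (M 0 + M 2) = M 1 := by linarith
  have e3 : 1 - (M 1 + M 2) = M 0 := by linarith
  have v0 : ν {0} = l 0 * G (M 0) := by
    rw [hνnotop {0} (by decide) (by decide)]; simp
  have v1 : ν {1} = l 1 * G (M 1) := by
    rw [hνnotop {1} (by decide) (by decide)]; simp
  have v01 : ν {0, 1} = l 1 * G (M 0 + M 1) := by
    rw [hνnotop {0, 1} (by decide) (by decide)]
    simp [Finset.sup'_insert, hl01.le]
  have v2 : ν {2} = l 2 * (G 1 - G (M 0 + M 1)) := by
    rw [hνtop {2} (by decide)]; simp [e1]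
  have v02 : ν {0, 2} = l 2 * (G 1 - G (M 1)) := by
    rw [hνtop {0, 2} (by decide)]; simp [e2]
  have v12 : ν {1, 2} = l 2 * (G 1 - G (M 0)) := by
    rw [hνtop {1, 2} (by decide)]; simp [e3]
  have vuniv : ν Finset.univ = l 2 * G 1 := by
    rw [hνtop _ (Finset.mem_univ _), Fin.sum_univ_three, hMsum]; simp [hG0]
  constructor
  · rintro ⟨x, hx, hJ⟩
    rw [vuniv, Fin.sum_univ_three] at hx
    have j01 := hJ {0, 1}
    have j02 := hJ {0, 2}
    have j12 := hJ {1, 2}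
    rw [v01, Finset.sum_pair (by decide)] at j01
    rw [v02, Finset.sum_pair (by decide)] at j02
    rw [v12, Finset.sum_pair (by decide)] at j12
    linarith
  · intro h
    have hsup := hGconv.add_le_map_add_of_map_zero hG0 h0 h1 (by linarith)
    have hl2 : 0 < l 2 := by linarith
    have a0 : l 0 * G (M 0) ≤ l 2 * G (M 0) :=
      mul_le_mul_of_nonneg_right (by linarith) (hGnn _ ⟨h0.le, by linarith⟩)
    have a1 : l 1 * G (M 1) ≤ l 2 * G (M 1) :=
      mul_le_mul_of_nonneg_right hl12.le (hGnn _ ⟨h1.le, by linarith⟩)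
    have a2 := mul_le_mul_of_nonneg_left hsup hl2.le
    refine ⟨![l 2 * G (M 0), l 2 * G (M 1), l 2 * (G 1 - G (M 0) - G (M 1))], ?_, ?_⟩
    · rw [vuniv, Fin.sum_univ_three]
      simp only [Matrix.cons_val]
      linarith
    · intro J
      have cases_J : J = ∅ ∨ J = {0} ∨ J = {1} ∨ J = {2} ∨ J = {0, 1} ∨ J = {0, 2} ∨
          J = {1, 2} ∨ J = Finset.univ := by
        revert J; decide
      rcases cases_J with rfl | rfl | rfl | rfl | rfl | rfl | rfl | rfl
      · simp [hν0]
      · rw [v0, Finset.sum_singleton]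
        exact a0
      · rw [v1, Finset.sum_singleton]
        exact a1
      · rw [v2, Finset.sum_singleton]
        simp only [Matrix.cons_val]
        linarith
      · rw [v01, Finset.sum_pair (by decide)]
        simp only [Matrix.cons_val]
        linarith
      · rw [v02, Finset.sum_pair (by decide)]
        simp only [Matrix.cons_val]
        linarith
      · rw [v12, Finset.sum_pair (by decide)]
        simp only [Matrix.cons_val]
        linarith
      · rw [vuniv, Fin.sum_univ_three]
        simp only [Matrix.cons_val]
        linarith
end

section
/- Let X be a compact Hausdorff space, μ a Borel probability measure on X, and ψ_1, …, ψ_N : X → ℝ continuous with μ{x : ψ_i(x) − ψ_j(x) = r} = 0 for all i ≠ j and all r ∈ ℝ. Define Ξ_ψ(p) := ∫_X max_{1≤i≤N} (ψ_i(x) − p_i) dμ(x) for p ∈ ℝ^N, and A_i(p) := {x ∈ X : ψ_i(x) − p_i > ψ_j(x) − p_j for all j ≠ i}. Then Ξ_ψ is convex on ℝ^N, is differentiable at every point p ∈ ℝ^N, and its partial derivatives satisfy ∂Ξ_ψ/∂p_i (p) = −μ(A_i(p)) for every i. -/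
open MeasureTheory

open Topology Filter

section FiniteSup

variable {ι : Type*} [Fintype ι]

theorem le_ciSup_of_fintype (v : ι → ℝ) (i : ι) : v i ≤ ⨆ j, v j :=
  le_ciSup (Set.finite_range v).bddAbove i

theorem ciSup_le_ciSup_add_norm_sub (v w : ι → ℝ) : ⨆ i, v i ≤ (⨆ i, w i) + ‖v - w‖ := by
  cases isEmpty_or_nonempty ι with
  | inl h => simp
  | inr h =>
    refine ciSup_le fun i => ?_
    have h₁ := le_ciSup_of_fintype w i
    have h₂ := (le_abs_self _).trans (norm_le_pi_norm (v - w) i)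
    simp only [Pi.sub_apply] at h₂
    linarith

theorem lipschitzWith_ciSup : LipschitzWith 1 (fun v : ι → ℝ => ⨆ i, v i) :=
  LipschitzWith.of_le_add fun v w => by
    rw [dist_eq_norm]
    exact ciSup_le_ciSup_add_norm_sub v w

theorem convexOn_ciSup : ConvexOn ℝ Set.univ (fun v : ι → ℝ => ⨆ i, v i) := by
  refine ⟨convex_univ, fun v _ w _ a b ha hb _ => ?_⟩
  cases isEmpty_or_nonempty ι with
  | inl h => simp
  | inr h =>
    refine ciSup_le fun i => ?_
    simp only [Pi.add_apply, Pi.smul_apply, smul_eq_mul]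
    gcongr
    · exact le_ciSup_of_fintype v i
    · exact le_ciSup_of_fintype w i

theorem ciSup_eventuallyEq_of_strict_max {v : ι → ℝ} {i : ι} (h : ∀ j, j ≠ i → v j < v i) :
    (fun w : ι → ℝ => ⨆ j, w j) =ᶠ[𝓝 v] fun w => w i := by
  have key : ∀ᶠ w : ι → ℝ in 𝓝 v, ∀ j, j ≠ i → w j < w i := by
    refine eventually_all.2 fun j => ?_
    by_cases hj : j = i
    · simp [hj]
    · filter_upwards [(continuous_apply j).continuousAt.eventually_lt
        (continuous_apply i).continuousAt (h j hj)] with w hw _ using hw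
  filter_upwards [key] with w hw
  have : Nonempty ι := ⟨i⟩
  refine le_antisymm (ciSup_le fun j => ?_) (le_ciSup_of_fintype w i)
  by_cases hj : j = i
  · rw [hj]
  · exact (hw j hj).le

theorem hasFDerivAt_ciSup_sub {a p : ι → ℝ} {i : ι}
    (h : ∀ j, j ≠ i → a j - p j < a i - p i) :
    HasFDerivAt (fun q : ι → ℝ => ⨆ j, (a j - q j))
      (-(ContinuousLinearMap.proj (R := ℝ) (φ := fun _ : ι => ℝ) i)) p := by
  have hlin : HasFDerivAt (fun q : ι → ℝ => a i - q i)
      (-(ContinuousLinearMap.proj (R := ℝ) (φ := fun _ : ι => ℝ) i)) p :=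
    (hasFDerivAt_apply i p).const_sub (a i)
  refine hlin.congr_of_eventuallyEq ?_
  have hc : Tendsto (fun q : ι → ℝ => a - q) (𝓝 p) (𝓝 (a - p)) :=
    (continuous_const.sub continuous_id).tendsto p
  exact hc.eventually (ciSup_eventuallyEq_of_strict_max (v := a - p) h)

end FiniteSup

section IntegralOfMax

variable {X ι : Type*} [Fintype ι]

/-- The set of points at which `i` is the strict maximizer of `ψ j x - p j`. -/
def strictMaxSet (ψ : ι → X → ℝ) (p : ι → ℝ) (i : ι) : Set X :=
  {x | ∀ j, j ≠ i → ψ j x - p j < ψ i x - p i}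

/-- The candidate differential of `q ↦ ⨆ j, (ψ j x - q j)` at `p`. -/
noncomputable def maxSubFDeriv (ψ : ι → X → ℝ) (p : ι → ℝ) (x : X) : (ι → ℝ) →L[ℝ] ℝ :=
  ∑ i, (strictMaxSet ψ p i).indicator
    (fun _ => -(ContinuousLinearMap.proj (R := ℝ) (φ := fun _ : ι => ℝ) i)) x

theorem maxSubFDeriv_eq {ψ : ι → X → ℝ} {p : ι → ℝ} {x : X} {i : ι}
    (hx : x ∈ strictMaxSet ψ p i) :
    maxSubFDeriv ψ p x = -(ContinuousLinearMap.proj (R := ℝ) (φ := fun _ : ι => ℝ) i) := by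
  unfold maxSubFDeriv
  rw [Finset.sum_eq_single i, Set.indicator_of_mem hx]
  · intro j _ hj
    refine Set.indicator_of_notMem (fun hxj => ?_) _
    exact lt_asymm (hx j hj) (hxj i hj.symm)
  · simp

theorem maxSubFDeriv_apply_single [DecidableEq ι] (ψ : ι → X → ℝ) (p : ι → ℝ) (x : X) (i : ι) :
    maxSubFDeriv ψ p x (Pi.single i 1) = (strictMaxSet ψ p i).indicator (fun _ => (-1 : ℝ)) x := by
  unfold maxSubFDeriv
  rw [_root_.sum_apply, Finset.sum_eq_single i]
  · by_cases hx : x ∈ strictMaxSet ψ p i <;> simp [hx]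
  · intro j _ hj
    by_cases hx : x ∈ strictMaxSet ψ p j <;> simp [hx, hj]
  · simp

theorem ae_exists_mem_strictMaxSet [Nonempty ι] [MeasurableSpace X] {μ : Measure X} {ψ : ι → X → ℝ}
    (htwist : ∀ i j, i ≠ j → ∀ r : ℝ, μ {x | ψ i x - ψ j x = r} = 0) (p : ι → ℝ) :
    ∀ᵐ x ∂μ, ∃ i, x ∈ strictMaxSet ψ p i := by
  have hne : ∀ᵐ x ∂μ, ∀ i j, i ≠ j → ψ i x - ψ j x ≠ p i - p j := by
    refine ae_all_iff.2 fun i => ae_all_iff.2 fun j => ?_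
    by_cases hij : i = j
    · simp [hij]
    · have h : ∀ᵐ x ∂μ, ψ i x - ψ j x ≠ p i - p j := by
        simpa [ae_iff] using htwist i j hij (p i - p j)
      filter_upwards [h] with x hx _ using hx
  filter_upwards [hne] with x hx
  obtain ⟨i, hi⟩ := Finite.exists_max fun j => ψ j x - p j
  refine ⟨i, fun j hj => lt_of_le_of_ne (hi j) fun heq => hx j i hj ?_⟩
  linarith

variable [TopologicalSpace X]

theorem isOpen_strictMaxSet {ψ : ι → X → ℝ} (hψ : ∀ i, Continuous (ψ i)) (p : ι → ℝ) (i : ι) :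
    IsOpen (strictMaxSet ψ p i) := by
  have : strictMaxSet ψ p i = ⋂ j, {x | j ≠ i → ψ j x - p j < ψ i x - p i} := by
    ext x
    simp [strictMaxSet]
  rw [this]
  refine isOpen_iInter_of_finite fun j => ?_
  by_cases hj : j = i
  · simp [hj]
  · simpa [hj] using isOpen_lt ((hψ j).sub continuous_const) ((hψ i).sub continuous_const)

theorem continuous_ciSup_sub {ψ : ι → X → ℝ} (hψ : ∀ i, Continuous (ψ i)) (p : ι → ℝ) :
    Continuous fun x => ⨆ i, (ψ i x - p i) :=
  (lipschitzWith_ciSup (ι := ι)).continuous.comp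
    (continuous_pi fun i => (hψ i).sub continuous_const)

variable [MeasurableSpace X] [BorelSpace X]

theorem integral_maxSubFDeriv_apply_single [DecidableEq ι] {μ : Measure X} {ψ : ι → X → ℝ}
    (hψ : ∀ i, Continuous (ψ i)) {p : ι → ℝ} (hint : Integrable (maxSubFDeriv ψ p) μ) (i : ι) :
    (∫ x, maxSubFDeriv ψ p x ∂μ) (Pi.single i 1) = -(μ (strictMaxSet ψ p i)).toReal := by
  rw [ContinuousLinearMap.integral_apply hint]
  simp only [maxSubFDeriv_apply_single]
  rw [integral_indicator_const _ (isOpen_strictMaxSet hψ p i).measurableSet]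
  simp [Measure.real]

variable [CompactSpace X]

theorem integrable_ciSup_sub {μ : Measure X} [IsFiniteMeasure μ] {ψ : ι → X → ℝ}
    (hψ : ∀ i, Continuous (ψ i)) (p : ι → ℝ) :
    Integrable (fun x => ⨆ i, (ψ i x - p i)) μ :=
  (continuous_ciSup_sub hψ p).integrable_of_hasCompactSupport (HasCompactSupport.of_compactSpace _)

theorem convexOn_integral_ciSup_sub (μ : Measure X) [IsFiniteMeasure μ] {ψ : ι → X → ℝ}
    (hψ : ∀ i, Continuous (ψ i)) :
    ConvexOn ℝ Set.univ fun p : ι → ℝ => ∫ x, (⨆ i, (ψ i x - p i)) ∂μ := by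
  refine ⟨convex_univ, fun p _ q _ a b ha hb hab => ?_⟩
  have hp := (integrable_ciSup_sub (μ := μ) hψ p).const_mul a
  have hq := (integrable_ciSup_sub (μ := μ) hψ q).const_mul b
  simp only [smul_eq_mul]
  rw [← integral_const_mul, ← integral_const_mul, ← integral_add hp hq]
  refine integral_mono (integrable_ciSup_sub hψ _) (hp.add hq) fun x => ?_
  have h := convexOn_ciSup.2 (Set.mem_univ fun i => ψ i x - p i)
    (Set.mem_univ fun i => ψ i x - q i) ha hb hab
  refine le_of_eq_of_le (iSup_congr fun i => ?_) h
  simp only [Pi.add_apply, Pi.smul_apply, smul_eq_mul]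
  linear_combination (-(ψ i x)) * hab

theorem hasFDerivAt_integral_ciSup_sub [Nonempty ι] (μ : Measure X) [IsFiniteMeasure μ]
    {ψ : ι → X → ℝ} (hψ : ∀ i, Continuous (ψ i))
    (htwist : ∀ i j, i ≠ j → ∀ r : ℝ, μ {x | ψ i x - ψ j x = r} = 0) (p : ι → ℝ) :
    Integrable (maxSubFDeriv ψ p) μ ∧
      HasFDerivAt (fun q : ι → ℝ => ∫ x, (⨆ i, (ψ i x - q i)) ∂μ)
        (∫ x, maxSubFDeriv ψ p x ∂μ) p := by
  refine hasFDerivAt_integral_of_dominated_loc_of_lip' (bound := fun _ => 1) univ_mem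
    (fun q _ => (integrable_ciSup_sub hψ q).aestronglyMeasurable) (integrable_ciSup_sub hψ p)
    ?_ ?_ (integrable_const 1) ?_
  · exact (Finset.stronglyMeasurable_fun_sum _ fun i _ => stronglyMeasurable_const.indicator
      (isOpen_strictMaxSet hψ p i).measurableSet).aestronglyMeasurable
  · refine Eventually.of_forall fun x q _ => ?_
    have h := lipschitzWith_ciSup.norm_sub_le (fun i => ψ i x - q i) fun i => ψ i x - p i
    have hsub : ((fun i => ψ i x - q i) - fun i => ψ i x - p i) = -(q - p) := by
      ext i
      simp only [Pi.sub_apply, Pi.neg_apply]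
      ring
    rw [hsub, norm_neg] at h
    simpa using h
  · filter_upwards [ae_exists_mem_strictMaxSet htwist p] with x ⟨i, hi⟩
    rw [maxSubFDeriv_eq hi]
    exact hasFDerivAt_ciSup_sub (a := fun j => ψ j x) hi

end IntegralOfMax

/-- Lemma `lemc1`: the functional `Ξ_ψ(p) = ∫ max_i (ψ_i − p_i) dμ`
is convex and everywhere differentiable on `ℝ^N`, with
`∂Ξ_ψ/∂p_i (p) = −μ(A_i(p))` where `A_i(p)` is the set where agent `i` is the
strict maximizer. -/
theorem Xi_convex_differentiable
    {X : Type*} [TopologicalSpace X] [CompactSpace X] [T2Space X]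
    [MeasurableSpace X] [BorelSpace X]
    (μ : Measure X) [IsProbabilityMeasure μ]
    {N : ℕ} (ψ : Fin N → X → ℝ) (hψc : ∀ i, Continuous (ψ i))
    (htwist : ∀ i j, i ≠ j → ∀ r : ℝ, μ {x | ψ i x - ψ j x = r} = 0) :
    ConvexOn ℝ Set.univ (fun p : Fin N → ℝ => ∫ x, (⨆ i, (ψ i x - p i)) ∂μ) ∧
    Differentiable ℝ (fun p : Fin N → ℝ => ∫ x, (⨆ i, (ψ i x - p i)) ∂μ) ∧
    ∀ (p : Fin N → ℝ) (i : Fin N),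
      fderiv ℝ (fun q : Fin N → ℝ => ∫ x, (⨆ j, (ψ j x - q j)) ∂μ) p (Pi.single i 1) =
        -(μ {x | ∀ j, j ≠ i → ψ j x - p j < ψ i x - p i}).toReal := by
  refine ⟨convexOn_integral_ciSup_sub μ hψc, fun p => ?_, fun p i => ?_⟩
  · cases isEmpty_or_nonempty (Fin N) with
    | inl h => simp
    | inr h => exact (hasFDerivAt_integral_ciSup_sub μ hψc htwist p).2.differentiableAt
  · have : Nonempty (Fin N) := ⟨i⟩
    obtain ⟨hint, hderiv⟩ := hasFDerivAt_integral_ciSup_sub μ hψc htwist p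
    rw [hderiv.fderiv]
    exact integral_maxSubFDeriv_apply_single hψc hint i
end

section
/- Let X be a compact Hausdorff space, μ a Borel probability measure on X, a > 0, and ψ_i : X × [0,a] → ℝ, i = 1,…,N, functions such that ψ_i(·, t) is continuous on X for each t, t ↦ ψ_i(x, t) is convex and differentiable on [0,a] for each x, and the t-derivatives ∂_t ψ_i are bounded on X × [0,a]. Define Ξ(p, t) := ∫_X max_{1≤i≤N} (ψ_i(x, t) − p_i) dμ(x). Then: (a) Ξ is convex on ℝ^N × [0,a]; and (b) if at a point (p, t) the partial derivative ∂_t Ξ(p, t) exists and μ{x : the maximum of j ↦ ψ_j(x,t) − p_j is attained by two distinct indices} = 0, then ∂_t Ξ(p, t) = Σ_{i=1}^N ∫_{A_i(p,t)} ∂_t ψ_i(x, t) dμ(x), where A_i(p,t) := {x : ψ_i(x,t) − p_i > ψ_j(x,t) − p_j for all j ≠ i}. -/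
open MeasureTheory Filter Topology

section FiniteSup

variable {ι X : Type*} [Finite ι]

theorem continuous_iSup_of_finite [TopologicalSpace X] {f : ι → X → ℝ}
    (hf : ∀ i, Continuous (f i)) : Continuous fun x => ⨆ i, f i x := by
  cases nonempty_fintype ι
  cases isEmpty_or_nonempty ι
  · simpa only [Real.iSup_of_isEmpty] using continuous_const
  · simp_rw [← Finset.sup'_univ_eq_ciSup]
    exact Continuous.finset_sup'_apply _ fun i _ => hf i

theorem abs_iSup_sub_iSup_le_of_finite [Nonempty ι] {f g : ι → ℝ} {c : ℝ}
    (h : ∀ i, |f i - g i| ≤ c) : |(⨆ i, f i) - ⨆ i, g i| ≤ c := by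
  have hle : ∀ {u v : ι → ℝ}, (∀ i, u i ≤ v i + c) → (⨆ i, u i) ≤ (⨆ i, v i) + c :=
    fun {u v} huv => ciSup_le fun i => (huv i).trans <| by
      gcongr
      exact le_ciSup (Set.finite_range v).bddAbove i
  rw [abs_sub_le_iff, sub_le_iff_le_add', sub_le_iff_le_add']
  exact ⟨hle fun i => by linarith [(abs_le.1 (h i)).2],
    hle fun i => by linarith [(abs_le.1 (h i)).1]⟩

theorem convexOn_iSup_of_finite {E : Type*} [AddCommMonoid E] [Module ℝ E] {s : Set E}
    (hs : Convex ℝ s) {f : ι → E → ℝ} (hf : ∀ i, ConvexOn ℝ s (f i)) :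
    ConvexOn ℝ s fun x => ⨆ i, f i x := by
  cases isEmpty_or_nonempty ι
  · simpa only [Real.iSup_of_isEmpty] using convexOn_const 0 hs
  refine ⟨hs, fun x hx y hy b c hb hc hbc => ciSup_le fun i => ?_⟩
  refine ((hf i).2 hx hy hb hc hbc).trans ?_
  have hxi := le_ciSup (Set.finite_range fun i => f i x).bddAbove i
  have hyi := le_ciSup (Set.finite_range fun i => f i y).bddAbove i
  simp only [smul_eq_mul]
  gcongr

theorem iSup_eq_of_forall_le_of_finite {f : ι → ℝ} {i : ι} (h : ∀ j, f j ≤ f i) :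
    (⨆ j, f j) = f i :=
  haveI : Nonempty ι := ⟨i⟩
  le_antisymm (ciSup_le h) (le_ciSup (Set.finite_range f).bddAbove i)

/-- Where a single function is strictly largest, the maximum inherits its derivative. -/
theorem hasDerivAt_iSup_of_strict_max {f : ι → ℝ → ℝ} {t d : ℝ} {i : ι}
    (hcont : ∀ j, ContinuousAt (f j) t) (hd : HasDerivAt (f i) d t)
    (hmax : ∀ j, j ≠ i → f j t < f i t) :
    HasDerivAt (fun s => ⨆ j, f j s) d t := by
  refine hd.congr_of_eventuallyEq ?_
  have hev : ∀ᶠ s in 𝓝 t, ∀ j, j ≠ i → f j s < f i s := by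
    refine eventually_all.2 fun j => ?_
    by_cases hj : j = i
    · exact Eventually.of_forall fun _ h => absurd hj h
    · filter_upwards [(hcont j).eventually_lt (hcont i) (hmax j hj)] with s hs _ using hs
  filter_upwards [hev] with s hs
  refine iSup_eq_of_forall_le_of_finite (f := fun j => f j s) fun j => ?_
  by_cases hj : j = i
  · rw [hj]
  · exact (hs j hj).le

end FiniteSup

/-- Integrating in a parameter preserves convexity. -/
theorem ConvexOn.integral_param {E X : Type*} [AddCommMonoid E] [Module ℝ E]
    [MeasurableSpace X] {μ : Measure X} {s : Set E} (hs : Convex ℝ s) {F : E → X → ℝ}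
    (hint : ∀ e, Integrable (F e) μ) (hF : ∀ x, ConvexOn ℝ s fun e => F e x) :
    ConvexOn ℝ s fun e => ∫ x, F e x ∂μ := by
  refine ⟨hs, fun u hu v hv b c hb hc hbc => ?_⟩
  simp only [← integral_smul]
  refine le_of_le_of_eq ?_ (integral_add ((hint u).smul b) ((hint v).smul c))
  exact integral_mono (hint _) (((hint u).smul b).add ((hint v).smul c))
    fun x => (hF x).2 hu hv hb hc hbc

/-- Differentiation under the integral sign within a set on which the integrand is uniformly
Lipschitz; in contrast to `hasDerivAt_integral_of_dominated_loc_of_lip`, the base point may lie on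
the boundary of the set. -/
theorem hasDerivWithinAt_integral_of_lip {X : Type*} [MeasurableSpace X] {μ : Measure X}
    [IsFiniteMeasure μ] {F : ℝ → X → ℝ} {F' : X → ℝ} {S : Set ℝ} {t C : ℝ}
    (hint : ∀ s, Integrable (F s) μ)
    (hlip : ∀ x, ∀ s ∈ S, |F s x - F t x| ≤ C * |s - t|)
    (hderiv : ∀ᵐ x ∂μ, HasDerivWithinAt (fun s => F s x) (F' x) S t) :
    HasDerivWithinAt (fun s => ∫ x, F s x ∂μ) (∫ x, F' x ∂μ) S t := by
  rw [hasDerivWithinAt_iff_tendsto_slope]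
  have hslope : slope (fun s => ∫ x, F s x ∂μ) t =
      fun s => ∫ x, slope (fun r => F r x) t s ∂μ := by
    funext s
    simp only [slope_def_module, smul_eq_mul]
    rw [integral_const_mul, integral_sub (hint s) (hint t)]
  rw [hslope]
  refine tendsto_integral_filter_of_dominated_convergence (fun _ => C)
    (Eventually.of_forall fun s => ?_) ?_ (integrable_const C) ?_
  · simp only [slope_def_module]
    exact (((hint s).sub (hint t)).smul (s - t)⁻¹).aestronglyMeasurable
  · filter_upwards [self_mem_nhdsWithin] with s hs
    refine Eventually.of_forall fun x => ?_
    have hpos : 0 < |s - t| := abs_pos.2 (sub_ne_zero.2 hs.2)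
    rw [slope_def_field, Real.norm_eq_abs, abs_div, div_le_iff₀ hpos]
    exact hlip x s hs.1
  · filter_upwards [hderiv] with x hx
    exact hasDerivWithinAt_iff_tendsto_slope.1 hx

theorem measurable_of_hasDerivAt {X : Type*} [MeasurableSpace X] {f : X → ℝ → ℝ} {f' : X → ℝ}
    {t : ℝ} (hf : ∀ s, Measurable fun x => f x s) (hd : ∀ x, HasDerivAt (f x) (f' x) t) :
    Measurable f' := by
  refine measurable_of_tendsto_metrizable' (f := fun s x => slope (f x) t s) (𝓝[≠] t)
    (fun s => ?_) (tendsto_pi_nhds.2 fun x => hasDerivAt_iff_tendsto_slope.1 (hd x))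
  simp only [slope_def_field]
  exact ((hf s).sub (hf t)).div_const _

/-- Lemma `lemc2`: convexity of the time-dependent dual functional
`Ξ(p,t) = ∫ max_i (ψ_i(x,t) − p_i) dμ` on `ℝ^N × [0,a]`, and the formula for its
`t`-derivative whenever it exists and the maximizing index is μ-a.e. unique. -/
theorem Xi_time_convex_and_derivative
    {X : Type*} [TopologicalSpace X] [CompactSpace X] [T2Space X]
    [MeasurableSpace X] [BorelSpace X]
    (μ : Measure X) [IsProbabilityMeasure μ]
    {N : ℕ} (a : ℝ) (ha : 0 < a)
    (ψ : Fin N → X → ℝ → ℝ) (ψ' : Fin N → X → ℝ → ℝ)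
    (hcont : ∀ i t, Continuous fun x => ψ i x t)
    (hconv : ∀ i x, ConvexOn ℝ (Set.Icc (0 : ℝ) a) (ψ i x))
    (hderiv : ∀ i x, ∀ t ∈ Set.Icc (0 : ℝ) a, HasDerivAt (ψ i x) (ψ' i x t) t)
    (C : ℝ) (hbdd : ∀ i x, ∀ t ∈ Set.Icc (0 : ℝ) a, |ψ' i x t| ≤ C) :
    -- (a) joint convexity
    ConvexOn ℝ ((Set.univ : Set (Fin N → ℝ)) ×ˢ Set.Icc (0 : ℝ) a)
      (fun q : (Fin N → ℝ) × ℝ => ∫ x, (⨆ i, (ψ i x q.2 - q.1 i)) ∂μ) ∧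
    -- (b) formula for the t-derivative when it exists
    (∀ (p : Fin N → ℝ) (t : ℝ), t ∈ Set.Icc (0 : ℝ) a →
      ∀ D : ℝ, HasDerivAt (fun s => ∫ x, (⨆ i, (ψ i x s - p i)) ∂μ) D t →
      μ {x | ∃ i j, i ≠ j ∧ (∀ k, ψ k x t - p k ≤ ψ i x t - p i) ∧
        ψ j x t - p j = ψ i x t - p i} = 0 →
      D = ∑ i, ∫ x in {x | ∀ j, j ≠ i → ψ j x t - p j < ψ i x t - p i},
            ψ' i x t ∂μ) := by
  have hint : ∀ (p : Fin N → ℝ) (s : ℝ), Integrable (fun x => ⨆ i, (ψ i x s - p i)) μ :=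
    fun p s => (continuous_iSup_of_finite fun i =>
      (hcont i s).sub continuous_const).integrable_of_hasCompactSupport
        (HasCompactSupport.of_compactSpace _)
  refine ⟨?_, fun p t ht D hD hnull => ?_⟩
  · have hconvex := (convex_univ (𝕜 := ℝ) (E := Fin N → ℝ)).prod (convex_Icc (0 : ℝ) a)
    refine ConvexOn.integral_param hconvex (fun q => hint q.1 q.2)
      fun x => convexOn_iSup_of_finite hconvex fun i => ⟨hconvex, ?_⟩
    intro u hu v hv b c hb hc hbc
    have h := (hconv i x).2 hu.2 hv.2 hb hc hbc
    simp only [Prod.snd_add, Prod.smul_snd, Prod.fst_add, Prod.smul_fst, Pi.add_apply,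
      Pi.smul_apply, smul_eq_mul] at h ⊢
    linarith
  set A : Fin N → Set X := fun i => {x | ∀ j, j ≠ i → ψ j x t - p j < ψ i x t - p i} with hA
  have hAmeas : ∀ i, MeasurableSet (A i) := fun i => by
    simp only [hA, Set.ofPred_forall]
    exact MeasurableSet.iInter fun j => MeasurableSet.iInter fun _ =>
      (isOpen_lt ((hcont j t).sub continuous_const)
        ((hcont i t).sub continuous_const)).measurableSet
  have hψ'int : ∀ i, Integrable (fun x => ψ' i x t) μ := fun i =>
    Integrable.of_bound (measurable_of_hasDerivAt (fun s => (hcont i s).measurable)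
      fun x => hderiv i x t ht).aestronglyMeasurable C
      (Eventually.of_forall fun x => hbdd i x t ht)
  rcases isEmpty_or_nonempty (Fin N) with hN | hN
  · simp only [Real.iSup_of_isEmpty, integral_zero] at hD
    simpa using hD.unique (hasDerivAt_const t 0)
  have hlip : ∀ x, ∀ s ∈ Set.Icc (0 : ℝ) a,
      |(⨆ i, (ψ i x s - p i)) - ⨆ i, (ψ i x t - p i)| ≤ C * |s - t| := by
    refine fun x s hs => abs_iSup_sub_iSup_le_of_finite fun i => ?_
    rw [sub_sub_sub_cancel_right]
    exact (convex_Icc (0 : ℝ) a).norm_image_sub_le_of_norm_hasDerivWithin_le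
      (fun r hr => (hderiv i x r hr).hasDerivWithinAt) (hbdd i x) ht hs
  have hae : ∀ᵐ x ∂μ, HasDerivWithinAt (fun s => ⨆ i, (ψ i x s - p i))
      (∑ i, (A i).indicator (fun x => ψ' i x t) x) (Set.Icc 0 a) t := by
    filter_upwards [measure_eq_zero_iff_ae_notMem.1 hnull] with x hx
    obtain ⟨i, hi⟩ := Finite.exists_max fun i => ψ i x t - p i
    have hmax : ∀ j, j ≠ i → ψ j x t - p j < ψ i x t - p i := fun j hj =>
      (hi j).lt_of_ne fun h => hx ⟨i, j, hj.symm, hi, h⟩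
    have hsum : ∑ j, (A j).indicator (fun x => ψ' j x t) x = ψ' i x t := by
      rw [Finset.sum_eq_single_of_mem i (Finset.mem_univ i)
        fun j _ hj => Set.indicator_of_notMem (fun h => (h i hj.symm).not_ge (hi j)) _]
      exact Set.indicator_of_mem (s := A i) hmax _
    rw [hsum]
    exact (hasDerivAt_iSup_of_strict_max (f := fun j s => ψ j x s - p j)
      (fun j => ((hderiv j x t ht).sub_const _).continuousAt)
      ((hderiv i x t ht).sub_const _) hmax).hasDerivWithinAt
  have hunique := (uniqueDiffOn_Icc ha t ht).eq_deriv _ hD.hasDerivWithinAt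
    (hasDerivWithinAt_integral_of_lip (hint p) hlip hae)
  rw [hunique, integral_finsetSum _ fun i _ => (hψ'int i).indicator (hAmeas i)]
  exact Finset.sum_congr rfl fun i _ => integral_indicator (hAmeas i)
end
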